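/- arXiv:2306.11567 — 2 statements merged into one kernel-verified Lean document; each statement's English description precedes it below -/
import Mathlib

section
/- Let d ≥ 1, α ∈ (0,2), and γ₁ > -1, and let μ₁ be the measure on ℝ × ℝ^d given by μ₁(A) = ∫_A x_d^{γ₁} 1_{{x_d>0}} dx dt. Then there exists a constant N > 0, depending only on d, α, and γ₁, such that for every z₀ = (t₀, x₀) with x₀ = (x₀', x_{0d}) ∈ ℝ^{d-1} × [0,∞), every ρ > 0, and every κ ∈ (0,1), one has μ₁(Q_{14ρ}^+(z₀)) ≤ N κ^{-(d + (γ₁)_+ + 2 - α)} μ₁(Q_{κρ}^+(z₀)), where (γ₁)_+ = max{γ₁, 0}. -/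
open MeasureTheory ENNReal Set

noncomputable section

abbrev Ed (d : ℕ) : Type := EuclideanSpace ℝ (Fin d)

/-- The last coordinate `x_d` of a point `x ∈ ℝ^d` (junk value `0` if `d = 0`). -/
def xd {d : ℕ} (x : Ed d) : ℝ :=
  if h : 0 < d then x ⟨d - 1, Nat.sub_lt h one_pos⟩ else 0

/-- The parabolic cylinder
`Q_ρ⁺(z₀) = (t₀ - ρ^{2-α}, t₀) × B_{r(ρ,x_{0d})}(x₀) ∩ {x_d > 0}` with
`r(ρ, x_{0d}) = max{ρ, x_{0d}}^{α/2} ρ^{1-α/2}`. -/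
def Qplus (d : ℕ) (α : ℝ) (z₀ : ℝ × Ed d) (ρ : ℝ) : Set (ℝ × Ed d) :=
  {z | z₀.1 - ρ ^ (2 - α) < z.1 ∧ z.1 < z₀.1 ∧
    dist z.2 z₀.2 < max ρ (xd z₀.2) ^ (α / 2) * ρ ^ (1 - α / 2) ∧ 0 < xd z.2}

/-- The measure `μ₁(A) = ∫_A x_d^{γ₁} 𝟙_{x_d>0} dx dt`. -/
def mu1 (d : ℕ) (γ₁ : ℝ) : Measure (ℝ × Ed d) :=
  volume.withDensity fun z =>
    if 0 < xd z.2 then ENNReal.ofReal (xd z.2 ^ γ₁) else 0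

/-- The one-dimensional weight `s ↦ s ^ γ 𝟙_{s > 0}`. -/
def halfLineWeight (γ s : ℝ) : ℝ≥0∞ := if 0 < s then ENNReal.ofReal (s ^ γ) else 0

lemma measurable_halfLineWeight (γ : ℝ) : Measurable (halfLineWeight γ) :=
  Measurable.ite measurableSet_Ioi (by fun_prop) measurable_const

lemma xd_succ {n : ℕ} (x : Ed (n + 1)) : xd x = x (Fin.last n) := by
  simp only [xd, Nat.succ_pos, dif_pos]
  rfl

lemma rpow_le_of_comparable {γ K x y : ℝ} (hK : 0 < K) (hx : 0 < x) (hy : 0 < y)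
    (hxy : x ≤ K * y) (hyx : y ≤ K * x) : x ^ γ ≤ K ^ |γ| * y ^ γ := by
  rcases le_total 0 γ with h | h
  · rw [abs_of_nonneg h, ← Real.mul_rpow hK.le hy.le]
    exact Real.rpow_le_rpow hx.le hxy h
  · rw [abs_of_nonpos h]
    have h1 : (K * x) ^ γ ≤ y ^ γ := Real.rpow_le_rpow_of_nonpos hy hyx h
    rw [Real.mul_rpow hK.le hx.le] at h1
    calc x ^ γ = K ^ (-γ) * (K ^ γ * x ^ γ) := by
          rw [← mul_assoc, ← Real.rpow_add hK]; simp
      _ ≤ K ^ (-γ) * y ^ γ := by gcongr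

lemma lintegral_halfLineWeight_Ioo_le {γ : ℝ} (hγ : -1 < γ) {a R : ℝ} (hR : 0 < R) :
    ∫⁻ s in Ioo (a - R) (a + R), halfLineWeight γ s ≤
      ENNReal.ofReal ((2 * 2 ^ |γ| + 3 ^ (γ + 1) / (γ + 1) * 2 ^ |γ|) * (R * max R a ^ γ)) := by
  have hγ1 : 0 < γ + 1 := by linarith
  have hM : 0 < max R a := hR.trans_le (le_max_left _ _)
  have hRM : 0 ≤ R * max R a ^ γ := by positivity
  rcases le_or_gt a (2 * R) with h | h
  · have hRγ : R ^ γ ≤ 2 ^ |γ| * max R a ^ γ := by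
      refine rpow_le_of_comparable two_pos hR hM ?_ (max_le (by linarith) h)
      linarith [le_max_left R a]
    have h_int : IntegrableOn (fun s : ℝ => s ^ γ) (Ioc 0 (3 * R)) := by
      rw [← intervalIntegrable_iff_integrableOn_Ioc_of_le (by positivity)]
      exact intervalIntegral.intervalIntegrable_rpow' hγ
    calc ∫⁻ s in Ioo (a - R) (a + R), halfLineWeight γ s
        ≤ ∫⁻ s in Ioc 0 (3 * R), ENNReal.ofReal (s ^ γ) := by
          rw [← lintegral_indicator measurableSet_Ioo, ← lintegral_indicator measurableSet_Ioc]
          refine lintegral_mono fun s => ?_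
          by_cases hs : s ∈ Ioo (a - R) (a + R)
          · by_cases hs0 : 0 < s
            · have : s ∈ Ioc 0 (3 * R) := ⟨hs0, by linarith [hs.2]⟩
              simp [hs, this, halfLineWeight, hs0]
            · simp [hs, halfLineWeight, hs0]
          · simp [hs]
      _ = ENNReal.ofReal ((3 * R) ^ (γ + 1) / (γ + 1)) := by
          rw [← ofReal_integral_eq_lintegral_ofReal h_int, ←
            intervalIntegral.integral_of_le (by positivity), integral_rpow (Or.inl hγ),
            Real.zero_rpow hγ1.ne', sub_zero]
          filter_upwards [ae_restrict_mem measurableSet_Ioc] with s hs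
          exact Real.rpow_nonneg hs.1.le _
      _ ≤ _ := by
          apply ENNReal.ofReal_le_ofReal
          calc (3 * R) ^ (γ + 1) / (γ + 1) = 3 ^ (γ + 1) / (γ + 1) * (R * R ^ γ) := by
                rw [Real.mul_rpow (by norm_num) hR.le, Real.rpow_add_one hR.ne']; ring
            _ ≤ 3 ^ (γ + 1) / (γ + 1) * (R * (2 ^ |γ| * max R a ^ γ)) := by gcongr
            _ ≤ _ := by
                have : 0 ≤ 2 * 2 ^ |γ| * (R * max R a ^ γ) := by positivity
                linarith
  · have hmax : max R a = a := max_eq_right (by linarith)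
    have ha : 0 < a := by linarith
    rw [hmax] at hRM ⊢
    calc ∫⁻ s in Ioo (a - R) (a + R), halfLineWeight γ s
        ≤ ∫⁻ _ in Ioo (a - R) (a + R), ENNReal.ofReal (2 ^ |γ| * a ^ γ) := by
          refine setLIntegral_mono measurable_const fun s hs => ?_
          have hs0 : 0 < s := by linarith [hs.1]
          rw [halfLineWeight, if_pos hs0]
          exact ENNReal.ofReal_le_ofReal (rpow_le_of_comparable two_pos hs0 ha
            (by linarith [hs.2]) (by linarith [hs.1]))
      _ = ENNReal.ofReal (2 ^ |γ| * a ^ γ * (2 * R)) := by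
          rw [setLIntegral_const, Real.volume_Ioo, ← ENNReal.ofReal_mul (by positivity)]
          congr 2; ring
      _ ≤ _ := by
          apply ENNReal.ofReal_le_ofReal
          have : 0 ≤ 3 ^ (γ + 1) / (γ + 1) * 2 ^ |γ| * (R * a ^ γ) := by positivity
          linarith

lemma le_lintegral_halfLineWeight_Ioo (γ : ℝ) {a δ : ℝ} (ha : 0 ≤ a) (hδ : 0 < δ) :
    ENNReal.ofReal ((2 ^ |γ|)⁻¹ / 2 * (δ * max δ a ^ γ)) ≤
      ∫⁻ s in Ioo (a - δ) (a + δ), halfLineWeight γ s := by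
  have hM : 0 < max δ a := hδ.trans_le (le_max_left _ _)
  calc ENNReal.ofReal ((2 ^ |γ|)⁻¹ / 2 * (δ * max δ a ^ γ))
      = ∫⁻ _ in Ioo (a + δ / 2) (a + δ), ENNReal.ofReal ((2 ^ |γ|)⁻¹ * max δ a ^ γ) := by
        rw [setLIntegral_const, Real.volume_Ioo, ← ENNReal.ofReal_mul (by positivity)]
        congr 1; ring
    _ ≤ ∫⁻ s in Ioo (a + δ / 2) (a + δ), halfLineWeight γ s := by
        refine setLIntegral_mono (measurable_halfLineWeight γ) fun s hs => ?_
        have hs0 : 0 < s := by linarith [hs.1]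
        rw [halfLineWeight, if_pos hs0]
        apply ENNReal.ofReal_le_ofReal
        rw [inv_mul_le_iff₀ (by positivity)]
        refine rpow_le_of_comparable two_pos hM hs0 ?_ ?_
        · exact max_le (by linarith [hs.1]) (by linarith [hs.1])
        · linarith [hs.2, le_max_left δ a, le_max_right δ a]
    _ ≤ _ := lintegral_mono_set (Ioo_subset_Ioo_left (by linarith))

/-- Fubini for the weighted measure on boxes. -/
lemma mu1_box {n : ℕ} (γ : ℝ) {T J : Set ℝ} (hJ : MeasurableSet J) {B : Fin n → Set ℝ}
    (hB : ∀ j, MeasurableSet (B j)) :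
    mu1 (n + 1) γ (T ×ˢ {x : Ed (n + 1) | x (Fin.last n) ∈ J ∧ ∀ j, x (Fin.castSucc j) ∈ B j}) =
      volume T * ((∫⁻ s in J, halfLineWeight γ s) * ∏ j, volume (B j)) := by
  have hw := measurable_halfLineWeight γ
  set φ : Ed (n + 1) → ℝ × (Fin n → ℝ) :=
    fun x => (x (Fin.last n), fun j => x (Fin.castSucc j)) with hφ_def
  have hφ : MeasurePreserving φ := by
    have h := (volume_preserving_piFinSuccAbove (fun _ : Fin (n + 1) => ℝ) (Fin.last n)).comp
      (PiLp.volume_preserving_ofLp (Fin (n + 1)))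
    convert h using 1
    ext x j
    · rfl
    · simp [hφ_def, MeasurableEquiv.piFinSuccAbove, Fin.init]
  have hmu : mu1 (n + 1) γ = (volume : Measure ℝ).prod
      ((volume : Measure (Ed (n + 1))).withDensity fun x => halfLineWeight γ (φ x).1) := by
    rw [prod_withDensity_right (g := fun x => halfLineWeight γ (φ x).1)
      (hw.comp (measurable_fst.comp hφ.measurable))]
    simp only [mu1, xd_succ]
    rfl
  have hA : MeasurableSet (J ×ˢ univ.pi B) := hJ.prod (MeasurableSet.univ_pi hB)
  have hS : {x : Ed (n + 1) | x (Fin.last n) ∈ J ∧ ∀ j, x (Fin.castSucc j) ∈ B j} =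
      φ ⁻¹' (J ×ˢ univ.pi B) := by
    ext x; simp [hφ_def]
  rw [hmu, Measure.prod_prod, hS, withDensity_apply _ (hφ.measurable hA),
    hφ.setLIntegral_comp_preimage hA (f := fun p => halfLineWeight γ p.1)
      (hw.comp measurable_fst), ← withDensity_apply _ hA, Measure.volume_eq_prod,
    ← prod_withDensity_left hw, Measure.prod_prod, withDensity_apply _ hJ, volume_pi,
    Measure.pi_pi]

/-- The spatial radius `r(ρ, a)` of a parabolic cylinder. -/
def cylRadius (α a ρ : ℝ) : ℝ := max ρ a ^ (α / 2) * ρ ^ (1 - α / 2)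

/-- The size `ρ ^ (2 - α) r ^ (n + 1) max(ρ, a) ^ γ` to which the weighted measure of a parabolic
cylinder is comparable. -/
def cylSize (n : ℕ) (α γ a ρ : ℝ) : ℝ :=
  ρ ^ (2 - α) * (cylRadius α a ρ ^ (n + 1) * max ρ a ^ γ)

lemma cylRadius_pos {α a ρ : ℝ} (hρ : 0 < ρ) : 0 < cylRadius α a ρ := by
  have : 0 < max ρ a := hρ.trans_le (le_max_left _ _)
  unfold cylRadius; positivity

lemma max_cylRadius {α a ρ : ℝ} (hα : α ∈ Ioo (0 : ℝ) 2) (hρ : 0 < ρ) :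
    max (cylRadius α a ρ) a = max ρ a := by
  have key : ∀ b : ℝ, 0 < b → b ^ (α / 2) * b ^ (1 - α / 2) = b := fun b hb => by
    rw [← Real.rpow_add hb]; simp
  unfold cylRadius
  rcases le_total a ρ with h | h
  · rw [max_eq_left h, key ρ hρ, max_eq_left h]
  · rw [max_eq_right h]
    refine max_eq_right ?_
    have ha : 0 < a := hρ.trans_le h
    have h1 : ρ ^ (1 - α / 2) ≤ a ^ (1 - α / 2) :=
      Real.rpow_le_rpow hρ.le h (by linarith [hα.2])
    calc a ^ (α / 2) * ρ ^ (1 - α / 2) ≤ a ^ (α / 2) * a ^ (1 - α / 2) := by gcongr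
      _ = a := key a ha

lemma cylSize_mul_le (n : ℕ) {α γ a ρ K : ℝ} (hα : α ∈ Ioo (0 : ℝ) 2) (ha : 0 ≤ a) (hρ : 0 < ρ)
    (hK : 1 ≤ K) :
    cylSize n α γ a (K * ρ) ≤
      K ^ (((n + 1 : ℕ) : ℝ) + max γ 0 + 2 - α) * cylSize n α γ a ρ := by
  have hK0 : 0 < K := by linarith
  have hM : 0 < max ρ a := hρ.trans_le (le_max_left _ _)
  have hρK : ρ ≤ K * ρ := le_mul_of_one_le_left hρ.le hK
  have hMM : max ρ a ≤ max (K * ρ) a := max_le_max_right _ hρK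
  have hM' : 0 < max (K * ρ) a := hM.trans_le hMM
  have hMK : max (K * ρ) a ≤ K * max ρ a := by
    rw [mul_max_of_nonneg _ _ hK0.le]
    exact max_le_max_left _ (le_mul_of_one_le_left ha hK)
  have hr : cylRadius α a (K * ρ) ≤ K * cylRadius α a ρ := by
    unfold cylRadius
    calc max (K * ρ) a ^ (α / 2) * (K * ρ) ^ (1 - α / 2)
        ≤ (K * max ρ a) ^ (α / 2) * (K * ρ) ^ (1 - α / 2) := by
          have := hα.1
          gcongr
      _ = K ^ (α / 2 + (1 - α / 2)) * (max ρ a ^ (α / 2) * ρ ^ (1 - α / 2)) := by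
          rw [Real.mul_rpow hK0.le hM.le, Real.mul_rpow hK0.le hρ.le, Real.rpow_add hK0]; ring
      _ = _ := by simp
  have hw : max (K * ρ) a ^ γ ≤ K ^ max γ 0 * max ρ a ^ γ := by
    rcases le_total 0 γ with h | h
    · rw [max_eq_left h, ← Real.mul_rpow hK0.le hM.le]
      exact Real.rpow_le_rpow hM'.le hMK h
    · rw [max_eq_right h, Real.rpow_zero, one_mul]
      exact Real.rpow_le_rpow_of_nonpos hM hMM h
  have hr0 := cylRadius_pos (α := α) (a := a) hρ
  have hr1 := cylRadius_pos (α := α) (a := a) (mul_pos hK0 hρ)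
  unfold cylSize
  calc (K * ρ) ^ (2 - α) * (cylRadius α a (K * ρ) ^ (n + 1) * max (K * ρ) a ^ γ)
      ≤ (K * ρ) ^ (2 - α) * ((K * cylRadius α a ρ) ^ (n + 1) * (K ^ max γ 0 * max ρ a ^ γ)) := by
        gcongr
    _ = (K ^ (n + 1) * K ^ max γ 0 * K ^ (2 - α)) *
          (ρ ^ (2 - α) * (cylRadius α a ρ ^ (n + 1) * max ρ a ^ γ)) := by
        rw [Real.mul_rpow hK0.le hρ.le, mul_pow]; ring
    _ = _ := by
        rw [← Real.rpow_natCast K (n + 1), ← Real.rpow_add hK0, ← Real.rpow_add hK0, add_sub_assoc]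

lemma mu1_Qplus_le (n : ℕ) {α γ : ℝ} (hα : α ∈ Ioo (0 : ℝ) 2) (hγ : -1 < γ) :
    ∃ C : ℝ, 0 < C ∧ ∀ z₀ : ℝ × Ed (n + 1), ∀ ρ : ℝ, 0 < ρ →
      mu1 (n + 1) γ (Qplus (n + 1) α z₀ ρ) ≤
        ENNReal.ofReal (C * cylSize n α γ (xd z₀.2) ρ) := by
  have hγ1 : 0 < γ + 1 := by linarith
  refine ⟨2 ^ n * (2 * 2 ^ |γ| + 3 ^ (γ + 1) / (γ + 1) * 2 ^ |γ|), by positivity,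
    fun z₀ ρ hρ => ?_⟩
  set a := xd z₀.2 with ha_def
  set r := cylRadius α a ρ with hr_def
  have hr : 0 < r := cylRadius_pos hρ
  have hM : 0 < max ρ a := hρ.trans_le (le_max_left _ _)
  have hsub : Qplus (n + 1) α z₀ ρ ⊆ Ioo (z₀.1 - ρ ^ (2 - α)) z₀.1 ×ˢ
      {x : Ed (n + 1) | x (Fin.last n) ∈ Ioo (a - r) (a + r) ∧ ∀ j : Fin n, x (Fin.castSucc j) ∈
        Ioo (z₀.2 (Fin.castSucc j) - r) (z₀.2 (Fin.castSucc j) + r)} := by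
    rintro z ⟨h1, h2, h3, -⟩
    have hj : ∀ j, z.2 j ∈ Ioo (z₀.2 j - r) (z₀.2 j + r) := fun j => by
      have h4 := (PiLp.norm_apply_le (z.2 - z₀.2) j).trans_lt (by rwa [dist_eq_norm] at h3)
      rw [PiLp.sub_apply, Real.norm_eq_abs, abs_lt] at h4
      change -r < _ ∧ _ < r at h4
      constructor <;> linarith [h4.1, h4.2]
    refine ⟨⟨h1, h2⟩, ?_, fun j => hj _⟩
    rw [ha_def, xd_succ]
    exact hj _
  refine (measure_mono hsub).trans ?_
  rw [mu1_box γ measurableSet_Ioo fun _ => measurableSet_Ioo]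
  simp only [Real.volume_Ioo, _root_.sub_sub_cancel, add_sub_sub_cancel, Finset.prod_const,
    Finset.card_univ, Fintype.card_fin]
  refine (mul_le_mul_right (mul_le_mul_left (lintegral_halfLineWeight_Ioo_le hγ hr) _) _).trans ?_
  rw [max_cylRadius hα hρ, ← ENNReal.ofReal_pow (by positivity),
    ← ENNReal.ofReal_mul (by positivity), ← ENNReal.ofReal_mul (by positivity)]
  apply ENNReal.ofReal_le_ofReal
  refine le_of_eq ?_
  rw [cylSize, ← hr_def]
  ring

lemma le_mu1_Qplus (n : ℕ) {α : ℝ} (γ : ℝ) (hα : α ∈ Ioo (0 : ℝ) 2) :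
    ∃ c : ℝ, 0 < c ∧ ∀ z₀ : ℝ × Ed (n + 1), 0 ≤ xd z₀.2 → ∀ ρ : ℝ, 0 < ρ →
      ENNReal.ofReal (c * cylSize n α γ (xd z₀.2) ρ) ≤
        mu1 (n + 1) γ (Qplus (n + 1) α z₀ ρ) := by
  set m : ℝ := n + 1 with hm_def
  have hm : 1 ≤ m := by simp [hm_def]
  have hm0 : 0 < m := by linarith
  refine ⟨(2 / m) ^ n * ((2 ^ |γ|)⁻¹ / 2 / m * (m ^ |γ|)⁻¹), by positivity,
    fun z₀ ha ρ hρ => ?_⟩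
  set a := xd z₀.2 with ha_def
  set r := cylRadius α a ρ with hr_def
  have hr : 0 < r := cylRadius_pos hρ
  have hM : 0 < max ρ a := hρ.trans_le (le_max_left _ _)
  set δ := r / m with hδ_def
  have hδ : 0 < δ := by positivity
  have hrδ : r = m * δ := by rw [hδ_def]; field_simp
  have hδr : δ ≤ r := by rw [hrδ]; exact le_mul_of_one_le_left hδ.le hm
  have hMδ : 0 < max δ a := hδ.trans_le (le_max_left _ _)
  set S : Set (Ed (n + 1)) := {x | x (Fin.last n) ∈ Ioo (a - δ) (a + δ) ∩ Ioi 0 ∧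
    ∀ j : Fin n, x (Fin.castSucc j) ∈
      Ioo (z₀.2 (Fin.castSucc j) - δ) (z₀.2 (Fin.castSucc j) + δ)} with hS_def
  have hsub : Ioo (z₀.1 - ρ ^ (2 - α)) z₀.1 ×ˢ S ⊆ Qplus (n + 1) α z₀ ρ := by
    rintro z ⟨⟨h1, h2⟩, ⟨h3, h4⟩, h5⟩
    refine ⟨h1, h2, ?_, by rwa [xd_succ]⟩
    change dist z.2 z₀.2 < r
    have hj : ∀ j, (z.2 j - z₀.2 j) ^ 2 < δ ^ 2 := by
      intro j
      rw [sq_lt_sq, abs_of_pos hδ, abs_lt]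
      refine Fin.lastCases ?_ (fun i => ?_) j
      · rw [ha_def, xd_succ] at h3
        constructor <;> linarith [h3.1, h3.2]
      · constructor <;> linarith [(h5 i).1, (h5 i).2]
    rw [EuclideanSpace.dist_eq]
    refine (Real.sqrt_lt_sqrt (by positivity) (y := ∑ _j : Fin (n + 1), δ ^ 2) ?_).trans_le ?_
    · refine Finset.sum_lt_sum_of_nonempty Finset.univ_nonempty fun j _ => ?_
      rw [Real.dist_eq, sq_abs]
      exact hj j
    · apply Real.sqrt_le_iff.2 ⟨hr.le, ?_⟩
      simp only [Finset.sum_const, Finset.card_univ, Fintype.card_fin, nsmul_eq_mul]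
      push_cast
      rw [hrδ, ← hm_def, mul_pow]
      gcongr
      nlinarith
  refine le_trans ?_ (measure_mono hsub)
  rw [hS_def, mu1_box γ (measurableSet_Ioo.inter measurableSet_Ioi) fun _ => measurableSet_Ioo]
  have hpos : ∫⁻ s in Ioo (a - δ) (a + δ) ∩ Ioi 0, halfLineWeight γ s =
      ∫⁻ s in Ioo (a - δ) (a + δ), halfLineWeight γ s := by
    rw [← lintegral_indicator (measurableSet_Ioo.inter measurableSet_Ioi),
      ← lintegral_indicator measurableSet_Ioo]
    refine lintegral_congr fun s => ?_
    by_cases hs : s ∈ Ioo (a - δ) (a + δ) <;> by_cases hs0 : 0 < s <;>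
      simp [indicator, halfLineWeight, hs0]
  rw [hpos]
  simp only [Real.volume_Ioo, _root_.sub_sub_cancel, add_sub_sub_cancel, Finset.prod_const,
    Finset.card_univ, Fintype.card_fin]
  refine le_trans ?_
    (mul_le_mul_right (mul_le_mul_left (le_lintegral_halfLineWeight_Ioo γ ha hδ) _) _)
  rw [← ENNReal.ofReal_pow (by positivity), ← ENNReal.ofReal_mul (by positivity),
    ← ENNReal.ofReal_mul (by positivity)]
  apply ENNReal.ofReal_le_ofReal
  have hcomp : (m ^ |γ|)⁻¹ * max ρ a ^ γ ≤ max δ a ^ γ := by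
    rw [inv_mul_le_iff₀ (by positivity), ← max_cylRadius (a := a) hα hρ, ← hr_def]
    have hM' : 0 < max r a := hr.trans_le (le_max_left _ _)
    have hle : max δ a ≤ max r a := max_le_max_right _ hδr
    refine rpow_le_of_comparable hm0 hM' hMδ ?_ (hle.trans (le_mul_of_one_le_left hM'.le hm))
    rw [mul_max_of_nonneg _ _ hm0.le, ← hrδ]
    exact max_le_max_left _ (le_mul_of_one_le_left ha hm)
  rw [cylSize, ← hr_def]
  calc (2 / m) ^ n * ((2 ^ |γ|)⁻¹ / 2 / m * (m ^ |γ|)⁻¹) *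
        (ρ ^ (2 - α) * (r ^ (n + 1) * max ρ a ^ γ))
      = ρ ^ (2 - α) * ((2 ^ |γ|)⁻¹ / 2 * (r / m * ((m ^ |γ|)⁻¹ * max ρ a ^ γ)) *
          (2 * (r / m)) ^ n) := by
        rw [show 2 * (r / m) = 2 / m * r by ring, mul_pow (2 / m)]; ring
    _ ≤ ρ ^ (2 - α) * ((2 ^ |γ|)⁻¹ / 2 * (δ * max δ a ^ γ) * (δ + δ) ^ n) := by
        rw [← hδ_def, ← two_mul]
        gcongr

/-- Doubling-type comparison (4.8) of the weighted measures of parabolic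
cylinders: `μ₁(Q_{14ρ}⁺(z₀)) ≤ N κ^{-(d + (γ₁)_+ + 2 - α)} μ₁(Q_{κρ}⁺(z₀))`. -/
theorem stmt10 (d : ℕ) (hd : 1 ≤ d) (α γ₁ : ℝ)
    (hα : α ∈ Set.Ioo (0 : ℝ) 2) (hγ : -1 < γ₁) :
    ∃ N : ℝ, 0 < N ∧
      ∀ z₀ : ℝ × Ed d, 0 ≤ xd z₀.2 → ∀ ρ : ℝ, 0 < ρ →
        ∀ κ : ℝ, κ ∈ Set.Ioo (0 : ℝ) 1 →
          mu1 d γ₁ (Qplus d α z₀ (14 * ρ))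
            ≤ ENNReal.ofReal (N * κ ^ (-((d : ℝ) + max γ₁ 0 + 2 - α))) *
                mu1 d γ₁ (Qplus d α z₀ (κ * ρ)) := by
  obtain ⟨n, rfl⟩ : ∃ n, d = n + 1 := ⟨d - 1, by omega⟩
  obtain ⟨C, hC, hupper⟩ := mu1_Qplus_le n hα hγ
  obtain ⟨c, hc, hlower⟩ := le_mu1_Qplus n γ₁ hα
  set p : ℝ := ((n + 1 : ℕ) : ℝ) + max γ₁ 0 + 2 - α with hp
  refine ⟨C / c * 14 ^ p, by positivity, fun z₀ ha ρ hρ κ hκ => ?_⟩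
  have hκ0 : 0 < κ := hκ.1
  have hκρ : 0 < κ * ρ := mul_pos hκ0 hρ
  have hK : 1 ≤ 14 / κ := by rw [le_div_iff₀ hκ0]; linarith [hκ.2]
  have hKp : (14 / κ) ^ p = 14 ^ p * κ ^ (-p) := by
    rw [Real.div_rpow (by norm_num) hκ0.le, Real.rpow_neg hκ0.le, div_eq_mul_inv]
  have hsize := cylSize_mul_le n (γ := γ₁) hα ha hκρ hK
  rw [show 14 / κ * (κ * ρ) = 14 * ρ by field_simp, ← hp, hKp] at hsize
  calc mu1 (n + 1) γ₁ (Qplus (n + 1) α z₀ (14 * ρ))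
      ≤ ENNReal.ofReal (C * cylSize n α γ₁ (xd z₀.2) (14 * ρ)) := hupper z₀ _ (by positivity)
    _ ≤ ENNReal.ofReal (C / c * 14 ^ p * κ ^ (-p) *
          (c * cylSize n α γ₁ (xd z₀.2) (κ * ρ))) := by
        apply ENNReal.ofReal_le_ofReal
        refine (mul_le_mul_of_nonneg_left hsize hC.le).trans_eq ?_
        field_simp
    _ ≤ ENNReal.ofReal (C / c * 14 ^ p * κ ^ (-p)) *
          mu1 (n + 1) γ₁ (Qplus (n + 1) α z₀ (κ * ρ)) := by
        rw [ENNReal.ofReal_mul (by positivity)]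
        exact mul_le_mul_right (hlower z₀ ha _ hκρ) _
end
end

section
/- Let d ≥ 1, ν ∈ (0,1), α ∈ (0,2), λ ≥ 0, and let μ, ā₀, c̄₀, ā_{ij} be as in the context. Let u be a function that is smooth, together with all its derivatives bounded, on a neighborhood of the closure of Q₁⁺ = (-1, 0) × (B₁ ∩ ℝ^d_+), satisfies u(t, x', 0) = 0 for (t, x', 0) in the closure of Q₁⁺, and satisfies ā₀(x_d)u_t + λ c̄₀(x_d)u - μ(x_d) ā_{ij}(x_d) D_iD_j u = 0 almost everywhere in Q₁⁺. Then for all integers k, j ≥ 0 and l ∈ {0,1}, and every partial derivative D_{x'}^j of order j in the variables x₁,...,x_{d-1}, one has ∫_{Q_{1/2}⁺} |∂_t^k D_{x'}^j D_d^l u|² dz ≤ N ∫_{Q₁⁺} u² dz, where N > 0 depends only on d, ν, α, k, j, l (in particular N is independent of λ), and Q_ρ⁺ = (-ρ^{2-α}, 0) × (B_ρ ∩ ℝ^d_+). -/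
open MeasureTheory ENNReal Set

noncomputable section

/-- `Ω_T = (-∞, T) × ℝ^d_+`. -/
def OmegaT (d : ℕ) (T : EReal) : Set (ℝ × Ed d) :=
  {z | (z.1 : EReal) < T ∧ 0 < xd z.2}

/-- Time derivative `u_t`. -/
def ut {d : ℕ} (u : ℝ × Ed d → ℝ) (z : ℝ × Ed d) : ℝ :=
  deriv (fun s => u (s, z.2)) z.1

/-- Spatial gradient `Du`. -/
def Du {d : ℕ} (u : ℝ × Ed d → ℝ) (z : ℝ × Ed d) : Ed d →L[ℝ] ℝ :=
  fderiv ℝ (fun y => u (z.1, y)) z.2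

/-- Spatial Hessian `D²u`. -/
def D2u {d : ℕ} (u : ℝ × Ed d → ℝ) (z : ℝ × Ed d) : Ed d →L[ℝ] Ed d →L[ℝ] ℝ :=
  fderiv ℝ (fun y => Du u (z.1, y)) z.2

/-- Spatial Laplacian `Δu`. -/
def lap {d : ℕ} (u : ℝ × Ed d → ℝ) (z : ℝ × Ed d) : ℝ :=
  ∑ i : Fin d, D2u u z (EuclideanSpace.single i 1) (EuclideanSpace.single i 1)

/-- Weighted Lebesgue norm `‖g‖_{L_p(Ω_T, x_d^γ dz)}`. -/
def wLp (d : ℕ) (T : EReal) (p γ : ℝ) (g : ℝ × Ed d → ℝ) : ℝ≥0∞ :=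
  (∫⁻ z in OmegaT d T, ENNReal.ofReal (|g z| ^ p * xd z.2 ^ γ)) ^ (1 / p)

/-- Conditions (1.3)–(1.4) on the (measurable) coefficients `μ, ā₀, c̄₀, ā_{ij}`,
depending only on the `x_d` variable. -/
def CoeffOK (d : ℕ) (ν α : ℝ) (μc a0 c0 : ℝ → ℝ) (aij : Fin d → Fin d → ℝ → ℝ) : Prop :=
  Measurable μc ∧ Measurable a0 ∧ Measurable c0 ∧ (∀ i j, Measurable (aij i j)) ∧
  (∀ s : ℝ, 0 < s →
      a0 s ∈ Set.Icc ν ν⁻¹ ∧ c0 s ∈ Set.Icc ν ν⁻¹ ∧ μc s / s ^ α ∈ Set.Icc ν ν⁻¹) ∧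
  (∀ s : ℝ, 0 < s → ∀ ξ : Fin d → ℝ,
      ν * ∑ i, ξ i ^ 2 ≤ ∑ i, ∑ j, aij i j s * ξ i * ξ j) ∧
  (∀ s : ℝ, 0 < s → ∀ i j, |aij i j s| ≤ ν⁻¹)

/-- `f = μ(x_d)⁻¹ (ā₀ u_t + λ c̄₀ u) - ā_{ij} D_i D_j u`, i.e. `𝓛₀ u = μ(x_d) f`. -/
def fL0 {d : ℕ} (μc a0 c0 : ℝ → ℝ) (aij : Fin d → Fin d → ℝ → ℝ) (lam : ℝ)
    (u : ℝ × Ed d → ℝ) (z : ℝ × Ed d) : ℝ :=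
  (μc (xd z.2))⁻¹ * (a0 (xd z.2) * ut u z + lam * c0 (xd z.2) * u z) -
    ∑ i, ∑ j, aij i j (xd z.2) *
      D2u u z (EuclideanSpace.single i 1) (EuclideanSpace.single j 1)
/-- Origin-centered cylinder `Q_ρ⁺ = (-ρ^{2-α}, 0) × (B_ρ ∩ ℝ^d_+)`. -/
def Qo (d : ℕ) (α ρ : ℝ) : Set (ℝ × Ed d) :=
  {z | -(ρ ^ (2 - α)) < z.1 ∧ z.1 < 0 ∧ ‖z.2‖ < ρ ∧ 0 < xd z.2}

/-- First-order spatial derivative `D_i`. -/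
def pd {d : ℕ} (i : Fin d) (u : ℝ × Ed d → ℝ) : ℝ × Ed d → ℝ :=
  fun z => Du u z (EuclideanSpace.single i 1)

/-- Time derivative `∂_t` as an operator. -/
def td {d : ℕ} (u : ℝ × Ed d → ℝ) : ℝ × Ed d → ℝ := fun z => ut u z

/-- The directional derivative of a function on space-time. -/
def dv {d : ℕ} (e : ℝ × Ed d) (f : ℝ × Ed d → ℝ) : ℝ × Ed d → ℝ := fun z => fderiv ℝ f z e

/-- The unit vector in the time direction. -/
def et (d : ℕ) : ℝ × Ed d := (1, 0)

/-- The unit vector in the direction of the `i`-th space coordinate. -/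
def ei {d : ℕ} (i : Fin d) : ℝ × Ed d := (0, EuclideanSpace.single i 1)

/-- The index of the last coordinate. -/
def lastIdx {d : ℕ} (hd : 1 ≤ d) : Fin d := ⟨d - 1, by omega⟩

section basics

variable {d : ℕ}

theorem contDiff_dv {f : ℝ × Ed d → ℝ} (hf : ContDiff ℝ (⊤ : ℕ∞) f) (e : ℝ × Ed d) :
    ContDiff ℝ (⊤ : ℕ∞) (dv e f) := by
  have h : ContDiff ℝ (⊤ : ℕ∞) (fderiv ℝ f) := hf.fderiv_right (by norm_cast)
  exact h.clm_apply contDiff_const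

theorem differentiable_of_smooth {f : ℝ × Ed d → ℝ} (hf : ContDiff ℝ (⊤ : ℕ∞) f) :
    Differentiable ℝ f := hf.differentiable (by simp)

theorem dv_comm {f : ℝ × Ed d → ℝ} (hf : ContDiff ℝ (⊤ : ℕ∞) f) (e e' : ℝ × Ed d) :
    dv e (dv e' f) = dv e' (dv e f) := by
  have h : ContDiff ℝ (⊤ : ℕ∞) (fderiv ℝ f) := hf.fderiv_right (by norm_cast)
  have hd : Differentiable ℝ (fderiv ℝ f) := h.differentiable (by simp)
  have key : ∀ a b : ℝ × Ed d, ∀ z, dv a (dv b f) z = fderiv ℝ (fderiv ℝ f) z a b := by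
    intro a b z
    have := ((hd z).hasFDerivAt.clm_apply (hasFDerivAt_const b z)).fderiv
    unfold dv
    rw [this]
    simp
  funext z
  rw [key, key]
  have hs : IsSymmSndFDerivAt ℝ f z :=
    (hf.contDiffAt).isSymmSndFDerivAt (by
      simp only [minSmoothness_of_isRCLikeNormedField]
      exact WithTop.coe_le_coe.2 (le_top : (2 : ℕ∞) ≤ ⊤))
  exact hs.eq e e'

theorem dv_mul {f g : ℝ × Ed d → ℝ} (hf : ContDiff ℝ (⊤ : ℕ∞) f) (hg : ContDiff ℝ (⊤ : ℕ∞) g)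
    (e z : ℝ × Ed d) : dv e (fun z => f z * g z) z = dv e f z * g z + f z * dv e g z := by
  have := ((differentiable_of_smooth hf z).hasFDerivAt.mul
    (differentiable_of_smooth hg z).hasFDerivAt).fderiv
  unfold dv
  change fderiv ℝ (f * g) z e = _
  rw [this]
  simp
  ring

theorem dv_pow {f : ℝ × Ed d → ℝ} (hf : ContDiff ℝ (⊤ : ℕ∞) f) (m : ℕ)
    (e z : ℝ × Ed d) : dv e (fun z => f z ^ (m + 1)) z = (m + 1) * f z ^ m * dv e f z := by
  have := ((differentiable_of_smooth hf z).hasFDerivAt.pow (m + 1)).fderiv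
  unfold dv
  rw [this]
  simp

theorem hasDerivAt_line {f : ℝ × Ed d → ℝ} (hf : ContDiff ℝ (⊤ : ℕ∞) f) (z e : ℝ × Ed d) (r : ℝ) :
    HasDerivAt (fun r : ℝ => f (z + r • e)) (dv e f (z + r • e)) r := by
  have h1 : HasDerivAt (fun r : ℝ => z + r • e) e r := by
    simpa using ((hasDerivAt_id r).smul_const e).const_add z
  exact (differentiable_of_smooth hf _).hasFDerivAt.comp_hasDerivAt r h1

theorem td_eq_dv {f : ℝ × Ed d → ℝ} (hf : ContDiff ℝ (⊤ : ℕ∞) f) : td f = dv (et d) f := by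
  funext z
  have h1 : HasDerivAt (fun s : ℝ => (s, z.2)) (et d) z.1 :=
    (hasDerivAt_id z.1).prodMk (hasDerivAt_const z.1 z.2)
  exact ((differentiable_of_smooth hf z).hasFDerivAt.comp_hasDerivAt z.1 h1).deriv

theorem Du_eq {f : ℝ × Ed d → ℝ} (hf : ContDiff ℝ (⊤ : ℕ∞) f) (z : ℝ × Ed d) :
    Du f z = (fderiv ℝ f z).comp (ContinuousLinearMap.inr ℝ ℝ (Ed d)) := by
  have h1 : HasFDerivAt (fun y : Ed d => (z.1, y)) (ContinuousLinearMap.inr ℝ ℝ (Ed d)) z.2 :=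
    (hasFDerivAt_const z.1 z.2).prodMk (hasFDerivAt_id z.2)
  exact ((differentiable_of_smooth hf z).hasFDerivAt.comp z.2 h1).fderiv

theorem pd_eq_dv {f : ℝ × Ed d → ℝ} (hf : ContDiff ℝ (⊤ : ℕ∞) f) (i : Fin d) :
    pd i f = dv (ei i) f := by
  funext z
  unfold pd
  rw [Du_eq hf]
  simp [dv, ei]

theorem D2u_eq_dv {f : ℝ × Ed d → ℝ} (hf : ContDiff ℝ (⊤ : ℕ∞) f) (i j : Fin d)
    (z : ℝ × Ed d) :
    D2u f z (EuclideanSpace.single i 1) (EuclideanSpace.single j 1) =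
      dv (ei i) (dv (ei j) f) z := by
  have hDf : ContDiff ℝ (⊤ : ℕ∞) (fderiv ℝ f) := hf.fderiv_right (by norm_cast)
  have hD : DifferentiableAt ℝ (fun y => Du f (z.1, y)) z.2 := by
    have : (fun y => Du f (z.1, y)) =
        fun y => (fderiv ℝ f (z.1, y)).comp (ContinuousLinearMap.inr ℝ ℝ (Ed d)) := by
      funext y
      exact Du_eq hf _
    rw [this]
    have h2 : ContDiff ℝ (⊤ : ℕ∞) (fun y : Ed d => fderiv ℝ f (z.1, y)) :=
      hDf.comp (contDiff_const.prodMk contDiff_id)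
    exact (h2.clm_comp contDiff_const).differentiable (by simp) _
  rw [← pd_eq_dv (contDiff_dv hf _), ← pd_eq_dv hf]
  have h := (hD.hasFDerivAt.clm_apply
    (hasFDerivAt_const (EuclideanSpace.single j (1 : ℝ)) z.2)).fderiv
  unfold pd
  unfold Du at h ⊢
  rw [h]
  simp [D2u]
  rfl

theorem xd_eq (hd : 1 ≤ d) (x : Ed d) : xd x = x (lastIdx hd) := by
  simp [xd, lastIdx, show 0 < d by omega]

theorem continuous_xd : Continuous (xd : Ed d → ℝ) := by
  rcases Nat.eq_zero_or_pos d with h | h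
  · subst h
    have : (xd : Ed 0 → ℝ) = fun _ => 0 := by
      funext x
      simp [xd]
    rw [this]
    exact continuous_const
  · have : (xd : Ed d → ℝ) = fun x => x (lastIdx h) := funext (xd_eq h)
    rw [this]
    fun_prop

theorem xd_add_smul (x y : Ed d) (r : ℝ) : xd (x + r • y) = xd x + r * xd y := by
  rcases Nat.eq_zero_or_pos d with h | h
  · subst h
    simp [xd]
  · simp [xd_eq h]

theorem xd_single_last (hd : 1 ≤ d) : xd (EuclideanSpace.single (lastIdx hd) (1 : ℝ)) = 1 := by
  simp [xd_eq hd]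

theorem xd_single_of_ne (hd : 1 ≤ d) {i : Fin d} (hi : i ≠ lastIdx hd) :
    xd (EuclideanSpace.single i (1 : ℝ)) = 0 := by
  simp [xd_eq hd, hi.symm]

end basics

instance {d : ℕ} : (volume : Measure (ℝ × Ed d)).IsAddRightInvariant := by
  change ((volume : Measure ℝ).prod (volume : Measure (Ed d))).IsAddRightInvariant
  infer_instance

/-- The full cylinder `(-R^{2-α}, R^{2-α}) × B_R`. -/
def Cyl (d : ℕ) (α R : ℝ) : Set (ℝ × Ed d) := {z | |z.1| < R ^ (2 - α) ∧ ‖z.2‖ < R}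

/-- The quarter space `{t < 0, x_d > 0}`. -/
def Quarter (d : ℕ) : Set (ℝ × Ed d) := {z | z.1 < 0 ∧ 0 < xd z.2}

section domains

variable {d : ℕ} {α R : ℝ}

theorem mem_Qo_iff {z : ℝ × Ed d} : z ∈ Qo d α R ↔ z ∈ Quarter d ∧ z ∈ Cyl d α R := by
  simp only [Qo, Quarter, Cyl, mem_ofPred_eq]
  constructor
  · rintro ⟨h1, h2, h3, h4⟩
    exact ⟨⟨h2, h4⟩, by rw [abs_of_neg h2]; linarith, h3⟩
  · rintro ⟨⟨h2, h4⟩, h1, h3⟩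
    rw [abs_of_neg h2] at h1
    exact ⟨by linarith, h2, h3, h4⟩

theorem continuous_xd_snd : Continuous (fun z : ℝ × Ed d => xd z.2) :=
  continuous_xd.comp continuous_snd

theorem isOpen_Quarter : IsOpen (Quarter d) :=
  (isOpen_lt continuous_fst continuous_const).inter (isOpen_lt continuous_const continuous_xd_snd)

theorem isOpen_Cyl : IsOpen (Cyl d α R) :=
  (isOpen_lt (continuous_abs.comp continuous_fst) continuous_const).inter
    (isOpen_lt (continuous_norm.comp continuous_snd) continuous_const)

theorem Qo_eq : Qo d α R = Quarter d ∩ Cyl d α R := by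
  ext z
  exact mem_Qo_iff

theorem isOpen_Qo : IsOpen (Qo d α R) := by
  rw [Qo_eq]
  exact isOpen_Quarter.inter isOpen_Cyl

/-- A compact set containing the cylinder. -/
def compactCyl (d : ℕ) (α R : ℝ) : Set (ℝ × Ed d) :=
  Icc (-(R ^ (2 - α))) (R ^ (2 - α)) ×ˢ Metric.closedBall (0 : Ed d) R

theorem isCompact_compactCyl : IsCompact (compactCyl d α R) :=
  isCompact_Icc.prod (isCompact_closedBall _ _)

theorem Cyl_subset_compactCyl : Cyl d α R ⊆ compactCyl d α R := by
  rintro z ⟨h1, h2⟩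
  exact ⟨abs_le.1 h1.le, by simpa using h2.le⟩

theorem Qo_subset_compactCyl : Qo d α R ⊆ compactCyl d α R :=
  fun _ hz => Cyl_subset_compactCyl (mem_Qo_iff.1 hz).2

theorem Qo_mono {r : ℝ} (hα : α < 2) (hr : 0 ≤ r) (h : r ≤ R) : Qo d α r ⊆ Qo d α R := by
  rintro z ⟨h1, h2, h3, h4⟩
  have := Real.rpow_le_rpow hr h (by linarith : 0 ≤ 2 - α)
  exact ⟨by linarith, h2, by linarith, h4⟩

theorem volume_Qo_lt_top : volume (Qo d α R) < ⊤ :=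
  (measure_mono Qo_subset_compactCyl).trans_lt (by
    change ((volume : Measure ℝ).prod (volume : Measure (Ed d))) _ < ⊤
    exact isCompact_compactCyl.measure_lt_top)

theorem exists_bound_of_continuous {f : ℝ × Ed d → ℝ} (hf : Continuous f) :
    ∃ C, 0 ≤ C ∧ ∀ z ∈ compactCyl d α R, |f z| ≤ C := by
  obtain ⟨C, hC⟩ := (isCompact_compactCyl (d := d) (α := α) (R := R)).exists_bound_of_continuousOn
    hf.continuousOn
  exact ⟨max C 0, le_max_right _ _, fun z hz => (hC z hz).trans (le_max_left _ _)⟩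

theorem integrableOn_Qo {f : ℝ × Ed d → ℝ} (hf : Measurable f) {C : ℝ}
    (hC : ∀ z ∈ Qo d α R, |f z| ≤ C) : IntegrableOn f (Qo d α R) :=
  Measure.integrableOn_of_bounded volume_Qo_lt_top.ne hf.aestronglyMeasurable (M := C)
    ((ae_restrict_iff' isOpen_Qo.measurableSet).2 (Filter.Eventually.of_forall hC))

theorem integrableOn_Qo_of_continuous {f : ℝ × Ed d → ℝ} (hf : Continuous f) :
    IntegrableOn f (Qo d α R) := by
  obtain ⟨C, -, hC⟩ := exists_bound_of_continuous (α := α) (R := R) hf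
  exact integrableOn_Qo hf.measurable fun z hz => hC z (Qo_subset_compactCyl hz)

theorem indicator_Quarter_eq {f : ℝ × Ed d → ℝ} (h0 : ∀ z, z ∉ Cyl d α R → f z = 0) :
    (Quarter d).indicator f = (Qo d α R).indicator f := by
  funext z
  classical
  simp only [indicator_apply, mem_Qo_iff]
  by_cases h : z ∈ Cyl d α R
  · simp [h]
  · simp [h, h0 z h]

theorem eq_zero_of_tsupport {g : ℝ × Ed d → ℝ} {S : Set (ℝ × Ed d)} (hs : tsupport g ⊆ S)
    {z : ℝ × Ed d} (hz : z ∉ S) : g z = 0 :=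
  image_eq_zero_of_notMem_tsupport fun h => hz (hs h)

theorem tsupport_dv_subset {g : ℝ × Ed d → ℝ} (e : ℝ × Ed d) :
    tsupport (dv e g) ⊆ tsupport g := by
  refine (closure_mono ?_).trans (tsupport_fderiv_subset ℝ (f := g))
  intro z hz
  simp only [Function.mem_support, dv] at hz ⊢
  intro h
  simp [h] at hz

end domains

section lines

theorem integral_halfline_right {g g' : ℝ → ℝ} (a : ℝ) (hg : Continuous g)
    (hd : ∀ r, a < r → HasDerivAt g (g' r) r) (hg' : Continuous g') :
    ∫ r in (0 : ℝ)..1, (if a < r then g' r else 0) = g (max 1 a) - g (max 0 a) := by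
  refine integral_eq_of_hasDerivAt_off_countable (fun r => g (max r a)) _ (countable_singleton a)
    (by fun_prop) ?_ ?_
  · rintro r ⟨-, hr⟩
    rcases lt_or_gt_of_ne (show r ≠ a from hr) with h | h
    · simp only [h.not_gt, if_false]
      refine (hasDerivAt_const r (g a)).congr_of_eventuallyEq ?_
      filter_upwards [eventually_lt_nhds h] with s hs
      simp [max_eq_right hs.le]
    · simp only [h, if_true]
      refine (hd r h).congr_of_eventuallyEq ?_
      filter_upwards [eventually_gt_nhds h] with s hs
      simp [max_eq_left hs.le]
  · have := (hg'.intervalIntegrable 0 1 (μ := volume)).def'.indicator (measurableSet_Ioi (a := a))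
    rw [intervalIntegrable_iff]
    refine this.congr_fun (fun r _ => ?_) measurableSet_uIoc
    simp [indicator_apply]

theorem integral_halfline_left {g g' : ℝ → ℝ} (a : ℝ) (hg : Continuous g)
    (hd : ∀ r, r < a → HasDerivAt g (g' r) r) (hg' : Continuous g') :
    ∫ r in (0 : ℝ)..1, (if r < a then g' r else 0) = g (min 1 a) - g (min 0 a) := by
  refine integral_eq_of_hasDerivAt_off_countable (fun r => g (min r a)) _ (countable_singleton a)
    (by fun_prop) ?_ ?_
  · rintro r ⟨-, hr⟩
    rcases lt_or_gt_of_ne (show r ≠ a from hr) with h | h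
    · simp only [h, if_true]
      refine (hd r h).congr_of_eventuallyEq ?_
      filter_upwards [eventually_lt_nhds h] with s hs
      simp [min_eq_left hs.le]
    · simp only [h.not_gt, if_false]
      refine (hasDerivAt_const r (g a)).congr_of_eventuallyEq ?_
      filter_upwards [eventually_gt_nhds h] with s hs
      simp [min_eq_right hs.le]
  · have := (hg'.intervalIntegrable 0 1 (μ := volume)).def'.indicator (measurableSet_Iio (a := a))
    rw [intervalIntegrable_iff]
    refine this.congr_fun (fun r _ => ?_) measurableSet_uIoc
    simp [indicator_apply]

/-- If the increments of `G` along `e` are dominated by the line integrals of `G'`, then `G'` has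
nonnegative integral, by translation invariance of Lebesgue measure. -/
theorem integral_nonneg_of_line {d : ℕ} (e : ℝ × Ed d) {G G' : ℝ × Ed d → ℝ} (hG : Integrable G)
    (hG' : Integrable G') (hm : Measurable G')
    (h : ∀ z, G (z + e) - G z ≤ ∫ r in (0 : ℝ)..1, G' (z + r • e)) : 0 ≤ ∫ z, G' z := by
  have hmeas : Measurable (fun p : (ℝ × Ed d) × ℝ => G' (p.1 + p.2 • e)) :=
    hm.comp (by fun_prop)
  have hint : Integrable (Function.uncurry fun (z : ℝ × Ed d) (r : ℝ) => G' (z + r • e))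
      ((volume : Measure (ℝ × Ed d)).prod (volume.restrict (Ioc (0 : ℝ) 1))) := by
    refine (integrable_prod_iff' hmeas.aestronglyMeasurable).2 ⟨?_, ?_⟩
    · exact Filter.Eventually.of_forall fun r => hG'.comp_add_right (r • e)
    · have : ∀ r : ℝ, ∫ x : ℝ × Ed d, ‖G' (x + r • e)‖ = ∫ x, ‖G' x‖ := fun r =>
        integral_add_right_eq_self (fun x => ‖G' x‖) (r • e)
      simp only [this]
      exact integrable_const _
  have h0 : ∫ z, (G (z + e) - G z) = 0 := by
    rw [integral_sub (hG.comp_add_right e) hG, integral_add_right_eq_self G e, sub_self]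
  have h1 : ∫ z, ∫ r in Ioc (0 : ℝ) 1, G' (z + r • e) = ∫ z, G' z := by
    rw [integral_integral_swap hint]
    have : ∀ r : ℝ, ∫ x : ℝ × Ed d, G' (x + r • e) = ∫ x, G' x := fun r =>
      integral_add_right_eq_self G' (r • e)
    simp_rw [this]
    simp
  rw [← h1]
  refine h0.symm.le.trans (integral_mono ((hG.comp_add_right e).sub hG)
    hint.integral_prod_left fun z => ?_)
  have := h z
  simpa only [intervalIntegral.integral_of_le zero_le_one] using this

end lines

section divergence

variable {d : ℕ} {α R : ℝ}

theorem integrable_indicator_Quarter {f : ℝ × Ed d → ℝ} (hf : Measurable f)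
    (h0 : ∀ z, z ∉ Cyl d α R → f z = 0) {C : ℝ} (hC : ∀ z ∈ Qo d α R, |f z| ≤ C) :
    Integrable ((Quarter d).indicator f) := by
  rw [indicator_Quarter_eq h0]
  exact (integrableOn_Qo hf hC).integrable_indicator isOpen_Qo.measurableSet

theorem integral_indicator_Quarter {f : ℝ × Ed d → ℝ}
    (h0 : ∀ z, z ∉ Cyl d α R → f z = 0) :
    ∫ z, (Quarter d).indicator f z = ∫ z in Qo d α R, f z := by
  rw [indicator_Quarter_eq h0, integral_indicator isOpen_Qo.measurableSet]

theorem continuous_line (z e : ℝ × Ed d) : Continuous fun r : ℝ => z + r • e := by fun_prop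

theorem integral_dv_tangential {e : ℝ × Ed d} (he1 : e.1 = 0) (he2 : xd e.2 = 0) {b : ℝ → ℝ}
    (hb : Measurable b) {C : ℝ} (hC : ∀ s, 0 < s → |b s| ≤ C) {g : ℝ × Ed d → ℝ}
    (hg : ContDiff ℝ (⊤ : ℕ∞) g) (hs : tsupport g ⊆ Cyl d α R) :
    ∫ z in Qo d α R, b (xd z.2) * dv e g z = 0 := by
  have aux : ∀ b : ℝ → ℝ, Measurable b → (∀ s, 0 < s → |b s| ≤ C) →
      0 ≤ ∫ z in Qo d α R, b (xd z.2) * dv e g z := by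
    intro b hb hC
    have hbm : Measurable fun z : ℝ × Ed d => b (xd z.2) := hb.comp continuous_xd_snd.measurable
    have key : ∀ f : ℝ × Ed d → ℝ, Continuous f → ∃ C', ∀ z ∈ Qo d α R,
        |b (xd z.2) * f z| ≤ C' := by
      intro f hf
      obtain ⟨M, hM0, hM⟩ := exists_bound_of_continuous (α := α) (R := R) hf
      refine ⟨C * M, fun z hz => ?_⟩
      rw [abs_mul]
      exact mul_le_mul (hC _ hz.2.2.2) (hM z (Qo_subset_compactCyl hz)) (abs_nonneg _)
        ((abs_nonneg _).trans (hC _ hz.2.2.2))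
    have hg' := (contDiff_dv hg e).continuous
    obtain ⟨C1, hC1⟩ := key g hg.continuous
    obtain ⟨C2, hC2⟩ := key _ hg'
    have z1 : ∀ z, z ∉ Cyl d α R → b (xd z.2) * g z = 0 := fun z hz => by
      rw [eq_zero_of_tsupport hs hz, mul_zero]
    have z2 : ∀ z, z ∉ Cyl d α R → b (xd z.2) * dv e g z = 0 := fun z hz => by
      rw [eq_zero_of_tsupport ((tsupport_dv_subset e).trans hs) hz, mul_zero]
    rw [← integral_indicator_Quarter z2]
    refine integral_nonneg_of_line e
      (integrable_indicator_Quarter (hbm.mul hg.continuous.measurable) z1 hC1)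
      (integrable_indicator_Quarter (hbm.mul hg'.measurable) z2 hC2)
      ((hbm.mul hg'.measurable).indicator isOpen_Quarter.measurableSet) ?_
    intro z
    have hline : ∀ r : ℝ, (z + r • e).1 = z.1 ∧ xd (z + r • e).2 = xd z.2 := fun r => by
      simp [he1, xd_add_smul, he2]
    have hmem : ∀ r : ℝ, (z + r • e ∈ Quarter d ↔ z ∈ Quarter d) := fun r => by
      simp only [Quarter, mem_ofPred_eq, hline]
    have hftc : ∫ r in (0 : ℝ)..1, dv e g (z + r • e) = g (z + e) - g z := by
      rw [intervalIntegral.integral_eq_sub_of_hasDerivAt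
        (fun r _ => hasDerivAt_line hg z e r)
        ((hg'.comp (continuous_line z e)).intervalIntegrable _ _)]
      simp
    have h1 := hmem 1
    have h2 := (hline 1).2
    rw [one_smul] at h1 h2
    by_cases hz : z ∈ Quarter d
    · simp only [indicator, hmem, hz, h1, h2, if_true, hline, intervalIntegral.integral_const_mul,
        hftc, Pi.mul_apply]
      exact le_of_eq (by ring)
    · simp [indicator, hmem, hz, h1]
  refine le_antisymm ?_ (aux b hb hC)
  have := aux (fun s => -b s) hb.neg (by simpa using hC)
  simp only [neg_mul, integral_neg] at this
  linarith

theorem integral_dv_time_nonneg {w : ℝ → ℝ} (hw : Measurable w) (hw0 : ∀ s, 0 < s → 0 ≤ w s)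
    {g : ℝ × Ed d → ℝ} (hg : ContDiff ℝ (⊤ : ℕ∞) g) (hs : tsupport g ⊆ Cyl d α R)
    (hg0 : ∀ z, 0 ≤ g z) {C1 C2 : ℝ} (hC1 : ∀ z ∈ Qo d α R, |w (xd z.2) * g z| ≤ C1)
    (hC2 : ∀ z ∈ Qo d α R, |w (xd z.2) * dv (et d) g z| ≤ C2) :
    0 ≤ ∫ z in Qo d α R, w (xd z.2) * dv (et d) g z := by
  have hwm : Measurable fun z : ℝ × Ed d => w (xd z.2) := hw.comp continuous_xd_snd.measurable
  have hg' := (contDiff_dv hg (et d)).continuous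
  have z1 : ∀ z, z ∉ Cyl d α R → w (xd z.2) * g z = 0 := fun z hz => by
    rw [eq_zero_of_tsupport hs hz, mul_zero]
  have z2 : ∀ z, z ∉ Cyl d α R → w (xd z.2) * dv (et d) g z = 0 := fun z hz => by
    rw [eq_zero_of_tsupport ((tsupport_dv_subset _).trans hs) hz, mul_zero]
  rw [← integral_indicator_Quarter z2]
  refine integral_nonneg_of_line (et d)
    (integrable_indicator_Quarter (hwm.mul hg.continuous.measurable) z1 hC1)
    (integrable_indicator_Quarter (hwm.mul hg'.measurable) z2 hC2)
    ((hwm.mul hg'.measurable).indicator isOpen_Quarter.measurableSet) ?_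
  intro z
  have hx : ∀ r : ℝ, (z + r • et d).2 = z.2 := fun r => by simp [et]
  have ht : ∀ r : ℝ, (z + r • et d).1 = z.1 + r := fun r => by simp [et]
  have hmem : ∀ r : ℝ, (z + r • et d ∈ Quarter d ↔ r < -z.1 ∧ 0 < xd z.2) := fun r => by
    simp only [Quarter, mem_ofPred_eq, hx, ht]
    constructor <;> rintro ⟨h1, h2⟩ <;> exact ⟨by linarith, h2⟩
  have hmem1 := hmem 1
  have hmem0 := hmem 0
  have hx1 := hx 1
  rw [one_smul] at hmem1 hx1
  rw [zero_smul, add_zero] at hmem0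
  by_cases hz : 0 < xd z.2
  · have hftc := integral_halfline_left (-z.1)
      (hg.continuous.comp (continuous_line z (et d))) (fun r _ => hasDerivAt_line hg z (et d) r)
      (hg'.comp (continuous_line z (et d)))
    have hR : ∫ r in (0 : ℝ)..1, (Quarter d).indicator
        (fun z => w (xd z.2) * dv (et d) g z) (z + r • et d) =
        w (xd z.2) * ∫ r in (0 : ℝ)..1, (if r < -z.1 then dv (et d) g (z + r • et d) else 0) := by
      rw [← intervalIntegral.integral_const_mul]
      congr 1
      funext r
      simp only [indicator, hmem, hz, and_true, hx]
      split_ifs <;> simp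
    rw [hR]
    simp only [Function.comp_apply] at hftc
    rw [hftc]
    have hw1 := hw0 _ hz
    simp only [indicator, hmem1, hmem0, hz, and_true, hx1, Pi.mul_apply]
    have e1 : z + (1 : ℝ) • et d = z + et d := by rw [one_smul]
    have e0 : z + (0 : ℝ) • et d = z := by rw [zero_smul, add_zero]
    by_cases c1 : (1 : ℝ) < -z.1
    · have c0 : (0 : ℝ) < -z.1 := by linarith
      rw [if_pos c1, if_pos c0, min_eq_left c1.le, min_eq_left c0.le, e1, e0]
      exact le_of_eq (by ring)
    · rw [if_neg c1, min_eq_right (not_lt.1 c1)]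
      by_cases c0 : (0 : ℝ) < -z.1
      · rw [if_pos c0, min_eq_left c0.le, e0]
        have := mul_nonneg hw1 (hg0 (z + -z.1 • et d))
        linarith
      · rw [if_neg c0, min_eq_right (not_lt.1 c0)]
        simp
  · simp [indicator, hmem, hmem1, hmem0, hz]

theorem exists_line_to_boundary (hd : 1 ≤ d) (z : ℝ × Ed d) (r : ℝ) :
    (z + r • ei (lastIdx hd)).1 = z.1 ∧ xd (z + r • ei (lastIdx hd)).2 = xd z.2 + r := by
  simp [ei, xd_add_smul, xd_single_last hd]

theorem mem_Quarter_line (hd : 1 ≤ d) (z : ℝ × Ed d) (r : ℝ) :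
    z + r • ei (lastIdx hd) ∈ Quarter d ↔ z.1 < 0 ∧ -xd z.2 < r := by
  obtain ⟨h1, h2⟩ := exists_line_to_boundary hd z r
  simp only [Quarter, mem_ofPred_eq, h1, h2]
  constructor <;> rintro ⟨h1, h2⟩ <;> exact ⟨h1, by linarith⟩

theorem integral_dv_last (hd : 1 ≤ d) {g : ℝ × Ed d → ℝ}
    (hg : ContDiff ℝ (⊤ : ℕ∞) g) (hs : tsupport g ⊆ Cyl d α R)
    (h0 : ∀ z : ℝ × Ed d, z.1 < 0 → xd z.2 = 0 → g z = 0) :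
    ∫ z in Qo d α R, dv (ei (lastIdx hd)) g z = 0 := by
  have aux : ∀ g : ℝ × Ed d → ℝ, ContDiff ℝ (⊤ : ℕ∞) g → tsupport g ⊆ Cyl d α R →
      (∀ z : ℝ × Ed d, z.1 < 0 → xd z.2 = 0 → g z = 0) →
      0 ≤ ∫ z in Qo d α R, dv (ei (lastIdx hd)) g z := by
    intro g hg hs h0
    set e : ℝ × Ed d := ei (lastIdx hd) with he
    have hg' := (contDiff_dv hg e).continuous
    have z1 : ∀ z, z ∉ Cyl d α R → g z = 0 := fun z hz => eq_zero_of_tsupport hs hz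
    have z2 : ∀ z, z ∉ Cyl d α R → dv e g z = 0 := fun z hz =>
      eq_zero_of_tsupport ((tsupport_dv_subset e).trans hs) hz
    obtain ⟨C1, -, hC1⟩ := exists_bound_of_continuous (α := α) (R := R) hg.continuous
    obtain ⟨C2, -, hC2⟩ := exists_bound_of_continuous (α := α) (R := R) hg'
    rw [← integral_indicator_Quarter z2]
    refine integral_nonneg_of_line e
      (integrable_indicator_Quarter hg.continuous.measurable z1
        fun z hz => hC1 z (Qo_subset_compactCyl hz))
      (integrable_indicator_Quarter hg'.measurable z2 fun z hz => hC2 z (Qo_subset_compactCyl hz))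
      (hg'.measurable.indicator isOpen_Quarter.measurableSet) ?_
    intro z
    have hmem := mem_Quarter_line hd z
    rw [← he] at hmem
    have hmem1 := hmem 1
    have hmem0 := hmem 0
    rw [one_smul] at hmem1
    rw [zero_smul, add_zero] at hmem0
    by_cases hz : z.1 < 0
    · have hftc := integral_halfline_right (-xd z.2)
        (hg.continuous.comp (continuous_line z e)) (fun r _ => hasDerivAt_line hg z e r)
        (hg'.comp (continuous_line z e))
      simp only [Function.comp_apply] at hftc
      simp only [indicator, hmem, hmem1, hmem0, hz, true_and]
      rw [hftc]
      have hb : g (z + (-xd z.2) • e) = 0 := by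
        obtain ⟨h1, h2⟩ := exists_line_to_boundary hd z (-xd z.2)
        exact h0 _ (by rw [h1]; exact hz) (by rw [h2]; ring)
      have e1 : z + (1 : ℝ) • e = z + e := by rw [one_smul]
      have e0 : z + (0 : ℝ) • e = z := by rw [zero_smul, add_zero]
      apply le_of_eq
      congr 1
      · split_ifs with c
        · rw [max_eq_left c.le, e1]
        · rw [max_eq_right (not_lt.1 c), hb]
      · split_ifs with c
        · rw [max_eq_left c.le, e0]
        · rw [max_eq_right (not_lt.1 c), hb]
    · simp [indicator, hmem, hmem1, hmem0, hz]
  refine le_antisymm ?_ (aux g hg hs h0)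
  have hneg : ∀ z, dv (ei (lastIdx hd)) (fun z => -g z) z = -dv (ei (lastIdx hd)) g z := fun z => by
    simp [dv, fderiv_fun_neg]
  have := aux (fun z => -g z) hg.neg
    ((closure_mono fun z hz => by simpa using hz).trans hs) fun z h1 h2 => by simp [h0 z h1 h2]
  simp only [hneg, integral_neg] at this
  linarith

theorem norm_add_smul_single_le (hd : 1 ≤ d) (x : Ed d) {r : ℝ} (h1 : r ≤ 0) (h2 : -xd x ≤ r) :
    ‖x + r • EuclideanSpace.single (lastIdx hd) (1 : ℝ)‖ ≤ ‖x‖ := by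
  rw [EuclideanSpace.norm_eq, EuclideanSpace.norm_eq]
  refine Real.sqrt_le_sqrt (Finset.sum_le_sum fun i _ => ?_)
  by_cases hi : i = lastIdx hd
  · subst hi
    rw [xd_eq hd] at h2
    simp only [PiLp.add_apply, PiLp.smul_apply, PiLp.single_apply, if_true, smul_eq_mul,
      mul_one, Real.norm_eq_abs, sq_abs]
    nlinarith
  · simp [hi]

/-- A smooth function vanishing on the flat boundary is bounded by a multiple of `x_d`. -/
theorem exists_abs_le_mul_xd (hd : 1 ≤ d) {g : ℝ × Ed d → ℝ} (hg : ContDiff ℝ (⊤ : ℕ∞) g)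
    (h0 : ∀ z ∈ Cyl d α R, z.1 < 0 → xd z.2 = 0 → g z = 0) :
    ∃ C, 0 ≤ C ∧ ∀ z ∈ Qo d α R, |g z| ≤ C * xd z.2 := by
  obtain ⟨C, hC0, hC⟩ := exists_bound_of_continuous (α := α) (R := R)
    (contDiff_dv hg (ei (lastIdx hd))).continuous
  refine ⟨C, hC0, fun z hz => ?_⟩
  have hx : 0 < xd z.2 := hz.2.2.2
  have hcyl : ∀ r ∈ Icc (-xd z.2) 0, z + r • ei (lastIdx hd) ∈ Cyl d α R := by
    intro r hr
    refine ⟨?_, ?_⟩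
    · simpa [ei] using (mem_Qo_iff.1 hz).2.1
    · refine lt_of_le_of_lt ?_ hz.2.2.1
      simpa [ei] using norm_add_smul_single_le hd z.2 hr.2 hr.1
  have := (convex_Icc (-xd z.2) 0).norm_image_sub_le_of_norm_hasDerivWithin_le
    (f := fun r : ℝ => g (z + r • ei (lastIdx hd))) (C := C)
    (fun r _ => (hasDerivAt_line hg z (ei (lastIdx hd)) r).hasDerivWithinAt)
    (fun r hr => hC _ (Cyl_subset_compactCyl (hcyl r hr)))
    (left_mem_Icc.2 (by linarith)) (right_mem_Icc.2 (by linarith))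
  obtain ⟨h1, h2⟩ := exists_line_to_boundary hd z (-xd z.2)
  rw [h0 _ (hcyl _ (left_mem_Icc.2 (by linarith))) (by rw [h1]; exact hz.2.1) (by rw [h2]; ring)]
    at this
  simpa [abs_of_pos hx] using this

end divergence

section hardy

variable {d : ℕ} {α R : ℝ}

theorem integral_sq_div_xd_le (hd : 1 ≤ d) {f : ℝ × Ed d → ℝ}
    (hf : ContDiff ℝ (⊤ : ℕ∞) f) (hs : tsupport f ⊆ Cyl d α R)
    (h0 : ∀ z : ℝ × Ed d, z.1 < 0 → xd z.2 = 0 → f z = 0) :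
    IntegrableOn (fun z => (f z / xd z.2) ^ 2) (Qo d α R) ∧
    ∫ z in Qo d α R, (f z / xd z.2) ^ 2 ≤
      4 * ∫ z in Qo d α R, dv (ei (lastIdx hd)) f z ^ 2 := by
  set e : ℝ × Ed d := ei (lastIdx hd) with he
  have hf' := (contDiff_dv hf e).continuous
  have hxm : Measurable fun z : ℝ × Ed d => xd z.2 := continuous_xd_snd.measurable
  obtain ⟨C, hC0, hC⟩ := exists_abs_le_mul_xd (R := R) (α := α) hd hf fun z _ => h0 z
  obtain ⟨C1, hC10, hC1⟩ := exists_bound_of_continuous (α := α) (R := R) hf.continuous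
  obtain ⟨C2, hC20, hC2⟩ := exists_bound_of_continuous (α := α) (R := R) hf'
  have hq : ∀ z ∈ Qo d α R, |f z / xd z.2| ≤ C := by
    intro z hz
    rw [abs_div, abs_of_pos (show 0 < xd z.2 from hz.2.2.2), div_le_iff₀ hz.2.2.2]
    exact hC z hz
  have hqm : Measurable fun z : ℝ × Ed d => f z / xd z.2 := hf.continuous.measurable.div hxm
  have hsqi : IntegrableOn (fun z => (f z / xd z.2) ^ 2) (Qo d α R) := by
    refine integrableOn_Qo (hqm.pow_const 2) (C := C ^ 2) fun z hz => ?_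
    rw [abs_pow]
    exact pow_le_pow_left₀ (abs_nonneg _) (hq z hz) 2
  refine ⟨hsqi, ?_⟩
  set G : ℝ × Ed d → ℝ := fun z => f z * (f z / xd z.2) with hG
  set G' : ℝ × Ed d → ℝ := fun z => 2 * dv e f z * (f z / xd z.2) - (f z / xd z.2) ^ 2 with hG'
  have z1 : ∀ z, z ∉ Cyl d α R → G z = 0 := fun z hz => by
    simp [hG, eq_zero_of_tsupport hs hz]
  have z2 : ∀ z, z ∉ Cyl d α R → G' z = 0 := fun z hz => by
    simp [hG', eq_zero_of_tsupport hs hz]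
  have hGm : Measurable G := hf.continuous.measurable.mul hqm
  have hG'm : Measurable G' :=
    ((hf'.measurable.const_mul 2).mul hqm).sub (hqm.pow_const 2)
  have hGb : ∀ z ∈ Qo d α R, |G z| ≤ C1 * C := fun z hz => by
    rw [hG, abs_mul]
    exact mul_le_mul (hC1 z (Qo_subset_compactCyl hz)) (hq z hz) (abs_nonneg _) hC10
  have hG'b : ∀ z ∈ Qo d α R, |G' z| ≤ 2 * C2 * C + C ^ 2 := fun z hz => by
    have h1 : |2 * dv e f z * (f z / xd z.2)| ≤ 2 * C2 * C := by
      rw [abs_mul, abs_mul, abs_two]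
      have := hC2 z (Qo_subset_compactCyl hz)
      exact mul_le_mul (by linarith) (hq z hz) (abs_nonneg _) (by positivity)
    have h2 : |(f z / xd z.2) ^ 2| ≤ C ^ 2 := by
      rw [abs_pow]
      exact pow_le_pow_left₀ (abs_nonneg _) (hq z hz) 2
    exact (abs_sub _ _).trans (add_le_add h1 h2)
  have main : 0 ≤ ∫ z in Qo d α R, G' z := by
    rw [← integral_indicator_Quarter z2]
    refine integral_nonneg_of_line e (integrable_indicator_Quarter hGm z1 hGb)
      (integrable_indicator_Quarter hG'm z2 hG'b)
      (hG'm.indicator isOpen_Quarter.measurableSet) ?_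
    intro z
    have hmem := mem_Quarter_line hd z
    rw [← he] at hmem
    have hmem1 := hmem 1
    have hmem0 := hmem 0
    rw [one_smul] at hmem1
    rw [zero_smul, add_zero] at hmem0
    by_cases hz : z.1 < 0
    · set a : ℝ := -xd z.2 with ha
      set φ : ℝ → ℝ := fun r => f (z + r • e) with hφ
      have hφd : ∀ r, HasDerivAt φ (dv e f (z + r • e)) r := fun r => hasDerivAt_line hf z e r
      have hφa : φ a = 0 := by
        obtain ⟨h1, h2⟩ := exists_line_to_boundary hd z a
        exact h0 _ (by rw [h1]; exact hz) (by rw [h2]; ring)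
      have hxr : ∀ r : ℝ, xd (z + r • e).2 = r - a := fun r => by
        rw [he, (exists_line_to_boundary hd z r).2]
        ring
      have hφdiff : Differentiable ℝ φ := fun r => (hφd r).differentiableAt
      have hφc : Continuous φ := hφdiff.continuous
      have hsc : Continuous (dslope φ a) := by
        rw [continuous_iff_continuousAt]
        intro r
        by_cases hr : r = a
        · subst hr
          exact continuousAt_dslope_same.2 (hφdiff _)
        · exact (continuousAt_dslope_of_ne hr).2 hφc.continuousAt
      have hsv : ∀ r, r ≠ a → dslope φ a r = φ r / (r - a) := fun r hr => by
        rw [dslope_of_ne _ hr, slope_def_field, hφa, sub_zero]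
      have hftc := integral_halfline_right (g := fun r => φ r * dslope φ a r)
        (g' := fun r => 2 * dv e f (z + r • e) * dslope φ a r - dslope φ a r ^ 2) a
        (hφc.mul hsc) (fun r hr => by
          have hne : r - a ≠ 0 := by linarith
          have h1 := (hφd r).mul ((hφd r).div ((hasDerivAt_id r).sub_const a) hne)
          have h2 : HasDerivAt (fun r => φ r * dslope φ a r) _ r :=
            h1.congr_of_eventuallyEq (by
              filter_upwards [eventually_gt_nhds hr] with s hs
              simp [hsv s hs.ne'])
          convert h2 using 1
          rw [hsv r hr.ne']
          simp only [id, Pi.div_apply]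
          field_simp
          ring)
        (by
          have := hf'.comp (continuous_line z e)
          simp only [Function.comp_def] at this
          fun_prop)
      have hcongr : ∀ r : ℝ, (Quarter d).indicator G' (z + r • e) =
          if a < r then 2 * dv e f (z + r • e) * dslope φ a r - dslope φ a r ^ 2 else 0 := by
        intro r
        simp only [indicator, hmem, hz, true_and]
        split_ifs with c
        · rw [hG', hsv r c.ne']
          simp only [hxr, hφ]
        · rfl
      have hval : ∀ r : ℝ, φ (max r a) * dslope φ a (max r a) =
          (Quarter d).indicator G (z + r • e) := by
        intro r
        simp only [indicator, hmem, hz, true_and]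
        split_ifs with c
        · rw [max_eq_left c.le, hsv r c.ne', hG]
          simp only [hxr, hφ]
        · rw [max_eq_right (not_lt.1 c), hφa, zero_mul]
      simp_rw [hcongr]
      rw [hftc, hval 1, hval 0, one_smul, zero_smul, add_zero]
    · simp [indicator, hmem, hmem1, hmem0, hz]
  have hb : IntegrableOn (fun z => dv e f z ^ 2) (Qo d α R) :=
    integrableOn_Qo_of_continuous (hf'.pow 2)
  have h2 : ∫ z in Qo d α R, G' z ≤
      ∫ z in Qo d α R, (2 * dv e f z ^ 2 - 1 / 2 * (f z / xd z.2) ^ 2) := by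
    refine integral_mono (integrableOn_Qo hG'm hG'b) ((hb.const_mul 2).sub (hsqi.const_mul _))
      fun z => ?_
    simp only [hG']
    nlinarith [sq_nonneg (2 * dv e f z - f z / xd z.2)]
  rw [integral_sub (hb.const_mul 2) (hsqi.const_mul _), integral_const_mul,
    integral_const_mul] at h2
  linarith

end hardy

section cutoff

variable {d : ℕ} {α : ℝ}

theorem exists_smooth_cutoff {K O : Set (ℝ × Ed d)} (hK : IsClosed K) (hO : IsOpen O)
    (h : K ⊆ O) : ∃ η : ℝ × Ed d → ℝ, ContDiff ℝ (⊤ : ℕ∞) η ∧ (∀ z, 0 ≤ η z ∧ η z ≤ 1) ∧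
      (∀ z ∈ K, η z = 1) ∧ tsupport η ⊆ O := by
  obtain ⟨V, hV, hKV, hVO⟩ := normal_exists_closure_subset hK hO h
  obtain ⟨f, hf1, hf0, hf⟩ := exists_contMDiffMap_one_nhds_of_subset_interior
    (modelWithCornersSelf ℝ (ℝ × Ed d)) (n := ⊤) hK (by rwa [hV.interior_eq])
  refine ⟨f, f.contMDiff.contDiff, fun z => hf z, fun z hz => ?_, ?_⟩
  · exact (Filter.eventually_of_mem hf1 fun _ h => h).self_of_nhdsSet z hz
  · refine (closure_mono fun z hz => ?_).trans hVO
    by_contra hzV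
    exact hz (hf0 z hzV)

theorem compactCyl_subset_Cyl {r R : ℝ} (hα : α < 2) (hr : 0 < r) (h : r < R) :
    compactCyl d α r ⊆ Cyl d α R := by
  rintro z ⟨h1, h2⟩
  have := Real.rpow_lt_rpow hr.le h (by linarith : 0 < 2 - α)
  exact ⟨(abs_le.2 h1).trans_lt this, (by simpa using h2 : ‖z.2‖ ≤ r).trans_lt h⟩

theorem exists_cylinder_cutoff {r R : ℝ} (hα : α < 2) (hr : 0 < r) (h : r < R) :
    ∃ η : ℝ × Ed d → ℝ, ContDiff ℝ (⊤ : ℕ∞) η ∧ (∀ z, 0 ≤ η z ∧ η z ≤ 1) ∧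
      (∀ z ∈ Qo d α r, η z = 1) ∧ tsupport η ⊆ Cyl d α R ∧
      ∃ M, 1 ≤ M ∧ ∀ z ∈ Qo d α R, |dv (et d) η z| ≤ M ∧ ∀ i, |dv (ei i) η z| ≤ M := by
  obtain ⟨η, h1, h2, h3, h4⟩ := exists_smooth_cutoff isCompact_compactCyl.isClosed isOpen_Cyl
    (compactCyl_subset_Cyl (d := d) hα hr h)
  refine ⟨η, h1, h2, fun z hz => h3 z (Qo_subset_compactCyl hz), h4, ?_⟩
  obtain ⟨M, hM0, hM⟩ := exists_bound_of_continuous (α := α) (R := R)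
    (contDiff_dv h1 (et d)).continuous
  choose N hN0 hN using fun i : Fin d => exists_bound_of_continuous (α := α) (R := R)
    (contDiff_dv h1 (ei i)).continuous
  have hS : 0 ≤ ∑ i, N i := Finset.sum_nonneg fun i _ => hN0 i
  refine ⟨1 + M + ∑ i, N i, by linarith, fun z hz => ⟨?_, fun i => ?_⟩⟩
  · have := hM z (Qo_subset_compactCyl hz)
    linarith
  · have h5 := hN i z (Qo_subset_compactCyl hz)
    have h6 := Finset.single_le_sum (fun i _ => hN0 i) (Finset.mem_univ i)
    linarith

/-- An interpolation between the weights `x^{-α}`, `x^{-2}` and `1`. -/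
theorem exists_pow_interpolation {α : ℝ} (hα0 : 0 < α) (hα : α < 2) :
    ∃ m : ℕ, ∀ δ x : ℝ, 0 ≤ δ → δ ≤ 1 → 0 < x →
      δ ^ (2 * m + 1) * x ^ (-α) ≤ δ ^ (2 * m + 2) * (x ^ 2)⁻¹ + 1 := by
  obtain ⟨m, hm⟩ := exists_nat_ge (α / (2 - α))
  refine ⟨m, fun δ x hδ0 hδ1 hx => ?_⟩
  have h2 : 0 < 2 - α := by linarith
  rcases hδ0.eq_or_lt with rfl | hδ
  · simp
  have hsq : (x ^ 2)⁻¹ = x ^ (-2 : ℝ) := by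
    rw [Real.rpow_neg hx.le]
    norm_cast
  have hsplit : x ^ (-α) = x ^ (-2 : ℝ) * x ^ (2 - α) := by
    rw [← Real.rpow_add hx]
    ring_nf
  have hx2 : 0 < x ^ (-2 : ℝ) := Real.rpow_pos_of_pos hx _
  by_cases hc : x ^ (2 - α) ≤ δ
  · have : δ ^ (2 * m + 1) * x ^ (-α) ≤ δ ^ (2 * m + 2) * (x ^ 2)⁻¹ := by
      rw [hsq, hsplit, pow_succ δ (2 * m + 1), mul_assoc]
      refine mul_le_mul_of_nonneg_left ?_ (by positivity)
      rw [mul_comm]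
      exact mul_le_mul_of_nonneg_right hc hx2.le
    linarith
  · push Not at hc
    have h3 : δ ^ (2 * m + 1) * x ^ (-α) ≤ 1 := by
      rw [Real.rpow_neg hx.le, ← div_eq_mul_inv, div_le_one (Real.rpow_pos_of_pos hx _)]
      by_cases hx1 : 1 ≤ x ^ α
      · exact (pow_le_one₀ hδ.le hδ1).trans hx1
      · push Not at hx1
        have hαm : α ≤ m * (2 - α) := by rwa [div_le_iff₀ h2] at hm
        have h4 : δ ^ (2 * m + 1) ≤ (x ^ (2 - α)) ^ (2 * m + 1) :=
          pow_le_pow_left₀ hδ.le hc.le _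
        by_cases hx1' : x ≤ 1
        · refine h4.trans ?_
          rw [← Real.rpow_natCast, ← Real.rpow_mul hx.le]
          refine Real.rpow_le_rpow_of_exponent_ge hx hx1' ?_
          push_cast
          have h0 : (0 : ℝ) ≤ m := Nat.cast_nonneg m
          nlinarith
        · push Not at hx1'
          exact absurd (Real.one_le_rpow hx1'.le hα0.le) (not_le.2 hx1)
    linarith [mul_nonneg (pow_nonneg hδ0 (2 * m + 2)) (inv_nonneg.2 (sq_nonneg x))]

end cutoff

/-- A measurable weight comparable to `s^{-α}`. -/
structure Weight (κ α : ℝ) (w : ℝ → ℝ) : Prop where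
  meas : Measurable w
  lower : ∀ s, 0 < s → κ * s ^ (-α) ≤ w s
  upper : ∀ s, 0 < s → w s ≤ κ⁻¹ * s ^ (-α)

/-- Coefficients normalised so that the last diagonal entry of the leading matrix is `1`. -/
structure Coef {d : ℕ} (hd : 1 ≤ d) (κ α : ℝ) (w c : ℝ → ℝ) (b : Fin d → Fin d → ℝ → ℝ) :
    Prop where
  weight_w : Weight κ α w
  weight_c : Weight κ α c
  meas_b : ∀ i j, Measurable (b i j)
  last : ∀ s, 0 < s → b (lastIdx hd) (lastIdx hd) s = 1
  bound : ∀ s, 0 < s → ∀ i j, |b i j s| ≤ κ⁻¹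
  elliptic : ∀ s, 0 < s → ∀ ξ : Fin d → ℝ,
    κ * ∑ i, ξ i ^ 2 ≤ ∑ i, ∑ j, b i j s * ξ i * ξ j

/-- The operator `w ∂_t v + λ c v - b_{ij} D_i D_j v`. -/
def opResidual {d : ℕ} (lam : ℝ) (w c : ℝ → ℝ) (b : Fin d → Fin d → ℝ → ℝ)
    (v : ℝ × Ed d → ℝ) (z : ℝ × Ed d) : ℝ :=
  w (xd z.2) * dv (et d) v z + lam * (c (xd z.2) * v z) -
    ∑ i, ∑ j, b i j (xd z.2) * dv (ei i) (dv (ei j) v) z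

/-- Globally smooth functions solving the equation in the unit half-cylinder and vanishing on its
flat boundary. -/
structure Sol {d : ℕ} (α lam : ℝ) (w c : ℝ → ℝ) (b : Fin d → Fin d → ℝ → ℝ)
    (v : ℝ × Ed d → ℝ) : Prop where
  smooth : ContDiff ℝ (⊤ : ℕ∞) v
  bdry : ∀ z ∈ Cyl d α 1, z.1 < 0 → xd z.2 = 0 → v z = 0
  eqn : ∀ᵐ z : ℝ × Ed d, z ∈ Qo d α 1 → opResidual lam w c b v z = 0

section weights

variable {κ α : ℝ} {w : ℝ → ℝ}

theorem Weight.nonneg (hw : Weight κ α w) (hκ : 0 < κ) {s : ℝ} (hs : 0 < s) : 0 ≤ w s :=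
  (mul_nonneg hκ.le (Real.rpow_nonneg hs.le _)).trans (hw.lower s hs)

theorem Weight.lower_of_le_one (hw : Weight κ α w) (hκ : 0 < κ) (hα : 0 < α) {s : ℝ} (hs : 0 < s)
    (hs1 : s ≤ 1) : κ ≤ w s := by
  have h1 : 1 ≤ s ^ (-α) := Real.one_le_rpow_of_pos_of_le_one_of_nonpos hs hs1 (by linarith)
  have := hw.lower s hs
  nlinarith

theorem Weight.abs_mul_le (hw : Weight κ α w) (hκ : 0 < κ) (hα : α < 2) {s x y A B : ℝ}
    (hs : 0 < s) (hs1 : s ≤ 1) (hA : 0 ≤ A) (hx : |x| ≤ A * s)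
    (hy : |y| ≤ B * s) : |w s * (x * y)| ≤ κ⁻¹ * (A * B) := by
  have h0 := hw.nonneg hκ hs
  have hκi : 0 < κ⁻¹ := inv_pos.2 hκ
  have hp : 0 ≤ s ^ (-α) := Real.rpow_nonneg hs.le _
  have hB : 0 ≤ B := by
    by_contra h
    push Not at h
    have := abs_nonneg y
    nlinarith
  rw [abs_mul, abs_mul, abs_of_nonneg h0]
  have h1 : |x| * |y| ≤ (A * B) * s ^ 2 := by
    calc |x| * |y| ≤ (A * s) * (B * s) := mul_le_mul hx hy (abs_nonneg _) (by positivity)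
      _ = _ := by ring
  have h2 : s ^ (-α) * s ^ 2 ≤ 1 := by
    rw [← Real.rpow_natCast s 2, ← Real.rpow_add hs]
    exact Real.rpow_le_one hs.le hs1 (by push_cast; linarith)
  calc w s * (|x| * |y|) ≤ (κ⁻¹ * s ^ (-α)) * ((A * B) * s ^ 2) :=
        mul_le_mul (hw.upper s hs) h1 (by positivity) (by positivity)
    _ = κ⁻¹ * (A * B) * (s ^ (-α) * s ^ 2) := by ring
    _ ≤ κ⁻¹ * (A * B) * 1 := by gcongr
    _ = _ := mul_one _

end weights

section flux

variable {d : ℕ} {κ α R lam : ℝ} {w c : ℝ → ℝ} {b : Fin d → Fin d → ℝ → ℝ}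

theorem xd_le_norm (x : Ed d) : xd x ≤ ‖x‖ := by
  rcases Nat.eq_zero_or_pos d with h | h
  · subst h
    simp [xd]
  · rw [xd_eq h]
    exact (le_abs_self _).trans (PiLp.norm_apply_le x _)

theorem xd_le_one (hR1 : R ≤ 1) {z : ℝ × Ed d} (hz : z ∈ Qo d α R) : xd z.2 ≤ 1 :=
  (xd_le_norm _).trans (hz.2.2.1.le.trans hR1)

theorem dv_eq_zero_of_line {f : ℝ × Ed d → ℝ} (hf : ContDiff ℝ (⊤ : ℕ∞) f) {z e : ℝ × Ed d}
    (h : ∀ᶠ r in nhds (0 : ℝ), f (z + r • e) = 0) : dv e f z = 0 := by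
  have h1 := hasDerivAt_line hf z e 0
  rw [zero_smul, add_zero] at h1
  exact h1.unique ((hasDerivAt_const (0 : ℝ) (0 : ℝ)).congr_of_eventuallyEq h)

/-- Vanishing on a relatively open part of the flat boundary passes to tangential derivatives. -/
theorem dv_eq_zero_of_bdry {f : ℝ × Ed d → ℝ} (hf : ContDiff ℝ (⊤ : ℕ∞) f) {e : ℝ × Ed d}
    (he : xd e.2 = 0) {O : Set (ℝ × Ed d)} (hO : IsOpen O)
    (h : ∀ z ∈ O, z.1 < 0 → xd z.2 = 0 → f z = 0) :
    ∀ z ∈ O, z.1 < 0 → xd z.2 = 0 → dv e f z = 0 := by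
  intro z hz h1 h2
  refine dv_eq_zero_of_line hf ?_
  have hc : Filter.Tendsto (fun r : ℝ => z + r • e) (nhds 0) (nhds z) := by
    simpa using (continuous_line z e).tendsto 0
  have hO' : IsOpen (O ∩ {z | z.1 < 0}) := hO.inter (isOpen_lt continuous_fst continuous_const)
  filter_upwards [hc (hO'.mem_nhds ⟨hz, h1⟩)] with r hr
  exact h _ hr.1 hr.2 (by simp [xd_add_smul, he, h2])

theorem opResidual_hasDerivAt {v : ℝ × Ed d → ℝ} (hv : ContDiff ℝ (⊤ : ℕ∞) v) {e : ℝ × Ed d}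
    (he : xd e.2 = 0) (z : ℝ × Ed d) :
    HasDerivAt (fun r : ℝ => opResidual lam w c b v (z + r • e))
      (opResidual lam w c b (dv e v) z) 0 := by
  have hx : ∀ r : ℝ, xd (z + r • e).2 = xd z.2 := fun r => by simp [xd_add_smul, he]
  have hline : ∀ {f : ℝ × Ed d → ℝ}, ContDiff ℝ (⊤ : ℕ∞) f →
      HasDerivAt (fun r : ℝ => f (z + r • e)) (dv e f z) 0 := fun hf => by
    simpa using hasDerivAt_line hf z e 0
  simp only [opResidual, hx]
  rw [dv_comm hv (et d) e]
  refine (((hline (contDiff_dv hv _)).const_mul _).add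
    (((hline hv).const_mul _).const_mul _)).sub ?_
  refine HasDerivAt.fun_sum fun i _ => HasDerivAt.fun_sum fun j _ => ?_
  rw [dv_comm hv (ei j) e, dv_comm (contDiff_dv hv _) (ei i) e]
  exact (hline (contDiff_dv (contDiff_dv hv _) _)).const_mul _

theorem Sol.tangential {v : ℝ × Ed d → ℝ} (hv : Sol α lam w c b v) {e : ℝ × Ed d} (he : xd e.2 = 0) :
    Sol α lam w c b (dv e v) where
  smooth := contDiff_dv hv.smooth e
  bdry := dv_eq_zero_of_bdry hv.smooth he isOpen_Cyl hv.bdry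
  eqn := by
    have hall : ∀ᵐ z : ℝ × Ed d, ∀ n : ℕ, z + (1 / ((n : ℝ) + 1)) • e ∈ Qo d α 1 →
        opResidual lam w c b v (z + (1 / ((n : ℝ) + 1)) • e) = 0 :=
      ae_all_iff.2 fun n => (measurePreserving_add_right volume _).quasiMeasurePreserving.ae hv.eqn
    filter_upwards [hv.eqn, hall] with z hz hzn hzQ
    have hd := opResidual_hasDerivAt (lam := lam) (w := w) (c := c) (b := b) hv.smooth he z
    rw [hasDerivAt_iff_tendsto_slope] at hd
    have hseq : Filter.Tendsto (fun n : ℕ => 1 / ((n : ℝ) + 1)) Filter.atTop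
        (nhdsWithin 0 {0}ᶜ) :=
      tendsto_nhdsWithin_iff.2 ⟨tendsto_one_div_add_atTop_nhds_zero_nat,
        Filter.Eventually.of_forall fun n => by
          simp only [mem_compl_iff, mem_singleton_iff]
          positivity⟩
    have h1 := hd.comp hseq
    refine tendsto_nhds_unique h1 (tendsto_const_nhds.congr' ?_)
    have hc : Filter.Tendsto (fun r : ℝ => z + r • e) (nhds 0) (nhds z) := by
      simpa using (continuous_line z e).tendsto 0
    filter_upwards [(hc.comp tendsto_one_div_add_atTop_nhds_zero_nat) (isOpen_Qo.mem_nhds hzQ)]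
      with n hn
    simp only [Function.comp_apply, slope_def_field, zero_smul, add_zero]
    rw [hzn n hn, hz hzQ]
    simp

theorem integrableOn_coef_mul {β : ℝ → ℝ} (hβ : Measurable β) {C : ℝ}
    (hC : ∀ s, 0 < s → |β s| ≤ C) {g : ℝ × Ed d → ℝ} (hg : Continuous g) :
    IntegrableOn (fun z => β (xd z.2) * g z) (Qo d α R) := by
  obtain ⟨M, hM0, hM⟩ := exists_bound_of_continuous (α := α) (R := R) hg
  refine integrableOn_Qo ((hβ.comp continuous_xd_snd.measurable).mul hg.measurable)
    (C := C * M) fun z hz => ?_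
  rw [abs_mul]
  exact mul_le_mul (hC _ hz.2.2.2) (hM z (Qo_subset_compactCyl hz)) (abs_nonneg _)
    ((abs_nonneg _).trans (hC _ hz.2.2.2))

theorem integrableOn_weight_mul (hd : 1 ≤ d) (hw : Weight κ α w) (hκ : 0 < κ) (hα : α < 2)
    (hR1 : R ≤ 1) {f g : ℝ × Ed d → ℝ} (hf : ContDiff ℝ (⊤ : ℕ∞) f)
    (hg : ContDiff ℝ (⊤ : ℕ∞) g)
    (hf0 : ∀ z ∈ Cyl d α R, z.1 < 0 → xd z.2 = 0 → f z = 0)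
    (hg0 : ∀ z ∈ Cyl d α R, z.1 < 0 → xd z.2 = 0 → g z = 0) :
    ∃ C, (∀ z ∈ Qo d α R, |w (xd z.2) * (f z * g z)| ≤ C) ∧
      IntegrableOn (fun z => w (xd z.2) * (f z * g z)) (Qo d α R) := by
  obtain ⟨A, hA0, hA⟩ := exists_abs_le_mul_xd hd hf hf0
  obtain ⟨B, hB0, hB⟩ := exists_abs_le_mul_xd hd hg hg0
  have h : ∀ z ∈ Qo d α R, |w (xd z.2) * (f z * g z)| ≤ κ⁻¹ * (A * B) := fun z hz =>
    hw.abs_mul_le hκ hα hz.2.2.2 (xd_le_one hR1 hz) hA0 (hA z hz) (hB z hz)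
  refine ⟨_, h, integrableOn_Qo ?_ h⟩
  exact (hw.meas.comp continuous_xd_snd.measurable).mul
    (hf.continuous.measurable.mul hg.continuous.measurable)

theorem time_flux_nonneg (hd : 1 ≤ d) (hw : Weight κ α w) (hκ : 0 < κ) (hα : α < 2)
    (hR1 : R ≤ 1) {f : ℝ × Ed d → ℝ} (hf : ContDiff ℝ (⊤ : ℕ∞) f)
    (hs : tsupport f ⊆ Cyl d α R)
    (hf0 : ∀ z ∈ Cyl d α R, z.1 < 0 → xd z.2 = 0 → f z = 0) :
    IntegrableOn (fun z => w (xd z.2) * dv (et d) (fun z => f z * f z) z) (Qo d α R) ∧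
      0 ≤ ∫ z in Qo d α R, w (xd z.2) * dv (et d) (fun z => f z * f z) z := by
  have het : xd (et d).2 = 0 := by
    have := xd_add_smul (0 : Ed d) 0 (1 : ℝ)
    simpa [et] using this
  have hft := dv_eq_zero_of_bdry hf het isOpen_Cyl hf0
  obtain ⟨C1, hC1, -⟩ := integrableOn_weight_mul hd hw hκ hα hR1 hf hf hf0 hf0
  obtain ⟨C2, hC2, hI⟩ := integrableOn_weight_mul hd hw hκ hα hR1 hf (contDiff_dv hf _) hf0 hft
  have heq : ∀ z, w (xd z.2) * dv (et d) (fun z => f z * f z) z =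
      2 * (w (xd z.2) * (f z * dv (et d) f z)) := fun z => by
    rw [dv_mul hf hf]
    ring
  have hsupp : tsupport (fun z => f z * f z) ⊆ Cyl d α R := by
    refine (closure_mono fun z hz => ?_).trans hs
    exact left_ne_zero_of_mul hz
  refine ⟨?_, integral_dv_time_nonneg (C1 := C1) (C2 := 2 * C2) hw.meas
    (fun s hs => hw.nonneg hκ hs) (hf.mul hf) hsupp (fun z => mul_self_nonneg _) hC1 ?_⟩
  · simp_rw [heq]
    exact hI.const_mul 2
  · intro z hz
    rw [heq, abs_mul, abs_two]
    exact mul_le_mul_of_nonneg_left (hC2 z hz) zero_le_two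

/-- The differentiation index used for moving a derivative off the second-order term. -/
def outerIdx (hd : 1 ≤ d) (i j : Fin d) : Fin d := if i = lastIdx hd then j else i

/-- The complementary index to `outerIdx`. -/
def innerIdx (hd : 1 ≤ d) (i j : Fin d) : Fin d := if i = lastIdx hd then i else j

theorem dv_outer_inner (hd : 1 ≤ d) {v : ℝ × Ed d → ℝ} (hv : ContDiff ℝ (⊤ : ℕ∞) v)
    (i j : Fin d) :
    dv (ei (outerIdx hd i j)) (dv (ei (innerIdx hd i j)) v) = dv (ei i) (dv (ei j) v) := by
  unfold outerIdx innerIdx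
  split_ifs
  · exact dv_comm hv _ _
  · rfl

theorem mul_outer_inner (hd : 1 ≤ d) (ξ : Fin d → ℝ) (i j : Fin d) :
    ξ (outerIdx hd i j) * ξ (innerIdx hd i j) = ξ i * ξ j := by
  unfold outerIdx innerIdx
  split_ifs
  · ring
  · rfl

theorem space_flux_eq_zero {hd : 1 ≤ d} (hcoef : Coef hd κ α w c b)
    {g : ℝ × Ed d → ℝ} (hg : ContDiff ℝ (⊤ : ℕ∞) g) (hs : tsupport g ⊆ Cyl d α R)
    (hg0 : ∀ z : ℝ × Ed d, z.1 < 0 → xd z.2 = 0 → g z = 0) (i j : Fin d) :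
    IntegrableOn (fun z => b i j (xd z.2) * dv (ei (outerIdx hd i j)) g z) (Qo d α R) ∧
      ∫ z in Qo d α R, b i j (xd z.2) * dv (ei (outerIdx hd i j)) g z = 0 := by
  refine ⟨integrableOn_coef_mul (hcoef.meas_b i j) (fun s hs => hcoef.bound s hs i j)
    (contDiff_dv hg _).continuous, ?_⟩
  by_cases h : outerIdx hd i j = lastIdx hd
  · have hij : i = lastIdx hd ∧ j = lastIdx hd := by
      unfold outerIdx at h
      split_ifs at h with hi
      · exact ⟨hi, h⟩
      · exact absurd h hi
    rw [h, hij.1, hij.2, ← integral_dv_last hd hg hs hg0]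
    refine setIntegral_congr_fun isOpen_Qo.measurableSet fun z hz => ?_
    simp only [hcoef.last _ hz.2.2.2, one_mul]
  · exact integral_dv_tangential (by simp [ei]) (by simpa [ei] using xd_single_of_ne hd h)
      (hcoef.meas_b i j) (fun s hs => hcoef.bound s hs i j) hg hs

end flux

section caccioppoli

variable {d : ℕ} {κ α lam : ℝ} {w c : ℝ → ℝ} {b : Fin d → Fin d → ℝ → ℝ}

/-- A smooth cutoff whose time derivative can be absorbed against the singular weight. -/
structure Cutoff (α r R M : ℝ) (ζ : ℝ × Ed d → ℝ) : Prop where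
  smooth : ContDiff ℝ (⊤ : ℕ∞) ζ
  nonneg : ∀ z, 0 ≤ ζ z
  le_one : ∀ z, ζ z ≤ 1
  eq_one : ∀ z ∈ Qo d α r, ζ z = 1
  supp : tsupport ζ ⊆ Cyl d α R
  time_le : ∀ z ∈ Qo d α R, |dv (et d) ζ z| ≤ M
  space_le : ∀ z ∈ Qo d α R, ∀ i, |dv (ei i) ζ z| ≤ M

theorem exists_cutoff (d : ℕ) {r R : ℝ} (hα0 : 0 < α) (hα : α < 2) (hr : 0 < r) (h : r < R) :
    ∃ (ζ : ℝ × Ed d → ℝ) (M : ℝ), 1 ≤ M ∧ Cutoff α r R M ζ ∧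
      ∀ ε, 0 < ε → ε ≤ 1 → ∃ C, 0 ≤ C ∧ ∀ z ∈ Qo d α R,
        |ζ z * dv (et d) ζ z| * xd z.2 ^ (-α) ≤ ε * ((ζ z) ^ 2 * (xd z.2 ^ 2)⁻¹) + C := by
  obtain ⟨η, h1, h2, h3, h4, M, hM, h5⟩ := exists_cylinder_cutoff (d := d) hα hr h
  obtain ⟨m, hm⟩ := exists_pow_interpolation hα0 hα
  set T : ℝ := (m + 1) * M with hT
  have hT1 : 1 ≤ T := by
    have : (0 : ℝ) ≤ m := by positivity
    nlinarith
  have hp0 : ∀ z, 0 ≤ η z ^ m := fun z => pow_nonneg (h2 z).1 _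
  have hp1 : ∀ z, η z ^ m ≤ 1 := fun z => pow_le_one₀ (h2 z).1 (h2 z).2
  have hbound : ∀ e z, |dv e η z| ≤ M → |dv e (fun z => η z ^ (m + 1)) z| ≤ T := by
    intro e z he
    rw [dv_pow h1, abs_mul, abs_of_nonneg (mul_nonneg (by positivity) (hp0 z)), hT]
    calc ((m : ℝ) + 1) * η z ^ m * |dv e η z| ≤ ((m : ℝ) + 1) * 1 * M := by
          gcongr
          exact hp1 z
      _ = _ := by ring
  refine ⟨fun z => η z ^ (m + 1), T, hT1, ⟨h1.pow _, fun z => pow_nonneg (h2 z).1 _,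
    fun z => pow_le_one₀ (h2 z).1 (h2 z).2, fun z hz => by simp [h3 z hz], ?_,
    fun z hz => hbound _ z (h5 z hz).1, fun z hz i => hbound _ z ((h5 z hz).2 i)⟩, ?_⟩
  · refine (closure_mono fun z hz => ?_).trans h4
    intro h0
    exact hz (by simp [h0])
  · intro ε hε hε1
    set δ : ℝ := ε / T with hδ
    have hT0 : 0 < T := by linarith
    have hδ0 : 0 < δ := by positivity
    have hδ1 : δ ≤ 1 := (div_le_one hT0).2 (hε1.trans hT1)
    refine ⟨T * (δ ^ (2 * m + 1))⁻¹, by positivity, fun z hz => ?_⟩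
    have hx := hz.2.2.2
    have hη0 := (h2 z).1
    have key := hm (δ * η z) (xd z.2) (by positivity) (mul_le_one₀ hδ1 hη0 (h2 z).2) hx
    have hxp : 0 ≤ xd z.2 ^ (-α) := Real.rpow_nonneg hx.le _
    have e1 : |η z ^ (m + 1) * dv (et d) (fun z => η z ^ (m + 1)) z| ≤ T * η z ^ (2 * m + 1) := by
      rw [dv_pow h1, abs_mul, abs_mul, abs_of_nonneg (pow_nonneg hη0 _),
        abs_of_nonneg (mul_nonneg (by positivity) (hp0 z))]
      calc η z ^ (m + 1) * (((m : ℝ) + 1) * η z ^ m * |dv (et d) η z|)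
          ≤ η z ^ (m + 1) * (((m : ℝ) + 1) * η z ^ m * M) := by
            gcongr
            exact (h5 z hz).1
        _ = _ := by rw [hT]; ring
    have e2 : η z ^ (2 * m + 1) * xd z.2 ^ (-α) ≤
        δ * (η z ^ (2 * m + 2) * (xd z.2 ^ 2)⁻¹) + (δ ^ (2 * m + 1))⁻¹ := by
      have hδp : 0 < δ ^ (2 * m + 1) := by positivity
      refine le_of_mul_le_mul_left ?_ hδp
      rw [mul_add, mul_inv_cancel₀ hδp.ne']
      calc δ ^ (2 * m + 1) * (η z ^ (2 * m + 1) * xd z.2 ^ (-α))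
          = (δ * η z) ^ (2 * m + 1) * xd z.2 ^ (-α) := by rw [mul_pow]; ring
        _ ≤ _ := key
        _ = _ := by rw [mul_pow]; ring
    calc _ ≤ T * η z ^ (2 * m + 1) * xd z.2 ^ (-α) := by gcongr
      _ = T * (η z ^ (2 * m + 1) * xd z.2 ^ (-α)) := by ring
      _ ≤ T * (δ * (η z ^ (2 * m + 2) * (xd z.2 ^ 2)⁻¹) + (δ ^ (2 * m + 1))⁻¹) := by gcongr
      _ = (T * δ) * ((η z ^ (m + 1)) ^ 2 * (xd z.2 ^ 2)⁻¹) + T * (δ ^ (2 * m + 1))⁻¹ := by ring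
      _ = _ := by rw [hδ, mul_div_cancel₀ _ hT0.ne']

theorem weight_rpow {κ : ℝ} (hκ : 0 < κ) (hκ1 : κ ≤ 1) : Weight κ α fun s => s ^ (-α) where
  meas := by fun_prop
  lower s hs := by
    have := Real.rpow_nonneg hs.le (-α)
    nlinarith
  upper s hs := by
    have := Real.rpow_nonneg hs.le (-α)
    have := (one_le_inv₀ hκ).2 hκ1
    nlinarith

/-- The squared length of the spatial gradient. -/
def gradSq (v : ℝ × Ed d → ℝ) (z : ℝ × Ed d) : ℝ := ∑ i, dv (ei i) v z ^ 2

theorem gradSq_nonneg (v : ℝ × Ed d → ℝ) (z : ℝ × Ed d) : 0 ≤ gradSq v z :=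
  Finset.sum_nonneg fun _ _ => sq_nonneg _

theorem sq_le_gradSq (v : ℝ × Ed d → ℝ) (z : ℝ × Ed d) (i : Fin d) :
    dv (ei i) v z ^ 2 ≤ gradSq v z :=
  Finset.single_le_sum (f := fun i => dv (ei i) v z ^ 2) (fun _ _ => sq_nonneg _)
    (Finset.mem_univ i)

theorem contDiff_gradSq {v : ℝ × Ed d → ℝ} (hv : ContDiff ℝ (⊤ : ℕ∞) v) :
    ContDiff ℝ (⊤ : ℕ∞) (gradSq v) :=
  ContDiff.sum fun i _ => (contDiff_dv hv (ei i)).pow 2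

theorem young_neg {γ a x : ℝ} (hγ : 0 < γ) : -(γ * a ^ 2 + γ⁻¹ * x ^ 2) ≤ 2 * (a * x) := by
  have h : γ * a ^ 2 + γ⁻¹ * x ^ 2 + 2 * (a * x) = γ * (a + γ⁻¹ * x) ^ 2 := by
    field_simp
    ring
  have : 0 ≤ γ * (a + γ⁻¹ * x) ^ 2 := by positivity
  linarith

/-- Integrating over the smaller cylinder drops the cutoff. -/
theorem setIntegral_le_of_cutoff {r R M : ℝ} (hα : α < 2) (hr : 0 ≤ r) (h : r ≤ R)
    {ζ : ℝ × Ed d → ℝ} (hζ : Cutoff α r R M ζ) {g : ℝ × Ed d → ℝ}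
    (hg0 : ∀ z ∈ Qo d α R, 0 ≤ g z) (hI : IntegrableOn (fun z => g z * ζ z ^ 2) (Qo d α R)) :
    ∫ z in Qo d α r, g z ≤ ∫ z in Qo d α R, g z * ζ z ^ 2 := by
  have e : ∫ z in Qo d α r, g z = ∫ z in Qo d α r, g z * ζ z ^ 2 :=
    setIntegral_congr_fun isOpen_Qo.measurableSet fun z hz => by simp [hζ.eq_one z hz]
  rw [e]
  refine setIntegral_mono_set hI ?_ (Qo_mono hα hr h).eventuallyLE
  exact (ae_restrict_iff' isOpen_Qo.measurableSet).2
    (Filter.Eventually.of_forall fun z hz => mul_nonneg (hg0 z hz) (sq_nonneg _))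

theorem Cutoff.mul_bdry {r R M : ℝ} {ζ : ℝ × Ed d → ℝ} (hζ : Cutoff α r R M ζ)
    (hR : 0 ≤ R) (hα : α < 2) (hR1 : R ≤ 1) {v : ℝ × Ed d → ℝ}
    (hv : ∀ z ∈ Cyl d α 1, z.1 < 0 → xd z.2 = 0 → v z = 0) :
    ∀ z : ℝ × Ed d, z.1 < 0 → xd z.2 = 0 → v z * ζ z = 0 := by
  intro z h1 h2
  by_cases hz : z ∈ Cyl d α R
  · have : z ∈ Cyl d α 1 :=
      ⟨hz.1.trans_le (Real.rpow_le_rpow hR hR1 (by linarith)), hz.2.trans_le hR1⟩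
    rw [hv z this h1 h2, zero_mul]
  · rw [eq_zero_of_tsupport hζ.supp hz, mul_zero]

theorem Cutoff.supp_mul {r R M : ℝ} {ζ : ℝ × Ed d → ℝ} (hζ : Cutoff α r R M ζ)
    (v : ℝ × Ed d → ℝ) : tsupport (fun z => v z * ζ z) ⊆ Cyl d α R :=
  (closure_mono fun _ hz => right_ne_zero_of_mul hz).trans hζ.supp

theorem caccioppoli_term {hd : 1 ≤ d} (hcoef : Coef hd κ α w c b) (hκ : 0 < κ)
    {r R M : ℝ} {ζ v : ℝ × Ed d → ℝ} (hζ : Cutoff α r R M ζ)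
    (hv : ContDiff ℝ (⊤ : ℕ∞) v) {γ : ℝ} (hγ : 0 < γ) {z : ℝ × Ed d} (hz : z ∈ Qo d α R)
    (i j : Fin d) :
    b i j (xd z.2) * (dv (ei i) v z * ζ z) * (dv (ei j) v z * ζ z) ≤
      b i j (xd z.2) * dv (ei (outerIdx hd i j))
        (fun z => dv (ei (innerIdx hd i j)) v z * (v z * ζ z * ζ z)) z -
      b i j (xd z.2) * dv (ei i) (dv (ei j) v) z * (v z * ζ z ^ 2) +
      (γ * (gradSq v z * ζ z ^ 2) + γ⁻¹ * (κ⁻¹ * M) ^ 2 * v z ^ 2) := by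
  have hζs := hζ.smooth
  have h1 := dv_outer_inner hd hv i j
  have h2 := mul_outer_inner hd (fun i => dv (ei i) v z) i j
  set σ := outerIdx hd i j
  set τ := innerIdx hd i j
  rw [dv_mul (contDiff_dv hv _) ((hv.mul hζs).mul hζs), h1, dv_mul (hv.mul hζs) hζs,
    dv_mul hv hζs]
  have hb := hcoef.bound _ hz.2.2.2 i j
  have hM := hζ.space_le z hz σ
  have hy := young_neg (γ := γ) (a := dv (ei τ) v z * ζ z)
    (x := b i j (xd z.2) * dv (ei σ) ζ z * v z) hγ
  have hbm : (b i j (xd z.2) * dv (ei σ) ζ z) ^ 2 ≤ (κ⁻¹ * M) ^ 2 := by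
    refine sq_le_sq.2 ?_
    have hM0 := (abs_nonneg _).trans hM
    rw [abs_mul, abs_of_nonneg (a := κ⁻¹ * M) (by positivity)]
    gcongr
  have hb2 : (b i j (xd z.2) * dv (ei σ) ζ z * v z) ^ 2 ≤ (κ⁻¹ * M) ^ 2 * v z ^ 2 := by
    rw [mul_pow]
    gcongr
  have hg : (dv (ei τ) v z * ζ z) ^ 2 ≤ gradSq v z * ζ z ^ 2 := by
    rw [mul_pow]
    exact mul_le_mul_of_nonneg_right (sq_le_gradSq v z τ) (sq_nonneg _)
  have hb3 : γ⁻¹ * (b i j (xd z.2) * dv (ei σ) ζ z * v z) ^ 2 ≤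
      γ⁻¹ * ((κ⁻¹ * M) ^ 2 * v z ^ 2) := mul_le_mul_of_nonneg_left hb2 (by positivity)
  have hg3 := mul_le_mul_of_nonneg_left hg hγ.le
  have h3 : b i j (xd z.2) * (dv (ei i) v z * ζ z) * (dv (ei j) v z * ζ z) =
      b i j (xd z.2) * (dv (ei σ) v z * dv (ei τ) v z) * ζ z ^ 2 := by
    rw [h2]
    ring
  rw [h3]
  nlinarith

theorem caccioppoli_pointwise {hd : 1 ≤ d} (hcoef : Coef hd κ α w c b) (hκ : 0 < κ)
    {r R M : ℝ} {ζ v : ℝ × Ed d → ℝ} (hζ : Cutoff α r R M ζ)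
    (hv : ContDiff ℝ (⊤ : ℕ∞) v) {ε C : ℝ}
    (hε : ∀ z ∈ Qo d α R,
        |ζ z * dv (et d) ζ z| * xd z.2 ^ (-α) ≤ ε * ((ζ z) ^ 2 * (xd z.2 ^ 2)⁻¹) + C)
    {z : ℝ × Ed d} (hz : z ∈ Qo d α R) (heq : opResidual lam w c b v z = 0) :
    κ / 2 * (gradSq v z * ζ z ^ 2) + lam * (c (xd z.2) * (v z * v z) * ζ z ^ 2) ≤
      (∑ i, ∑ j, b i j (xd z.2) * dv (ei (outerIdx hd i j))
        (fun z => dv (ei (innerIdx hd i j)) v z * (v z * ζ z * ζ z)) z) -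
      1 / 2 * (w (xd z.2) * dv (et d) (fun z => (v z * ζ z) * (v z * ζ z)) z) +
      κ⁻¹ * ε * (v z * ζ z / xd z.2) ^ 2 +
      (κ⁻¹ * C + d ^ 2 * ((κ / (2 * d ^ 2))⁻¹ * (κ⁻¹ * M) ^ 2)) * v z ^ 2 := by
  have hd0 : (0 : ℝ) < d := by exact_mod_cast hd
  have hx := hz.2.2.2
  have hγ : 0 < κ / (2 * (d : ℝ) ^ 2) := by positivity
  have hsum := Finset.sum_le_sum fun i (_ : i ∈ (Finset.univ : Finset (Fin d))) =>
    Finset.sum_le_sum fun j (_ : j ∈ (Finset.univ : Finset (Fin d))) =>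
      caccioppoli_term hcoef hκ hζ hv hγ hz i j
  have hell := hcoef.elliptic _ hx fun i => dv (ei i) v z * ζ z
  simp only [Finset.sum_add_distrib, Finset.sum_sub_distrib, ← Finset.sum_mul, Finset.sum_const,
    Finset.card_univ, Fintype.card_fin, nsmul_eq_mul] at hsum
  have hgs : ∑ i, (dv (ei i) v z * ζ z) ^ 2 = gradSq v z * ζ z ^ 2 := by
    simp_rw [mul_pow, ← Finset.sum_mul, gradSq]
  rw [hgs] at hell
  have heq' : ∑ i, ∑ j, b i j (xd z.2) * dv (ei i) (dv (ei j) v) z =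
      w (xd z.2) * dv (et d) v z + lam * (c (xd z.2) * v z) := by
    unfold opResidual at heq
    linarith
  rw [heq'] at hsum
  have hW : dv (et d) (fun z => (v z * ζ z) * (v z * ζ z)) z =
      2 * (v z * ζ z * (dv (et d) v z * ζ z + v z * dv (et d) ζ z)) := by
    rw [dv_mul (hv.mul hζ.smooth) (hv.mul hζ.smooth), dv_mul hv hζ.smooth]
    ring
  rw [hW]
  have hwt : w (xd z.2) * (ζ z * dv (et d) ζ z) * v z ^ 2 ≤
      κ⁻¹ * ε * (v z * ζ z / xd z.2) ^ 2 + κ⁻¹ * C * v z ^ 2 := by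
    have hw0 := hcoef.weight_w.nonneg hκ hx
    have h1 : w (xd z.2) * (ζ z * dv (et d) ζ z) ≤
        κ⁻¹ * (ε * ((ζ z) ^ 2 * (xd z.2 ^ 2)⁻¹) + C) := by
      calc w (xd z.2) * (ζ z * dv (et d) ζ z)
          ≤ w (xd z.2) * |ζ z * dv (et d) ζ z| := by gcongr; exact le_abs_self _
        _ ≤ κ⁻¹ * xd z.2 ^ (-α) * |ζ z * dv (et d) ζ z| := by
            gcongr
            exact hcoef.weight_w.upper _ hx
        _ = κ⁻¹ * (|ζ z * dv (et d) ζ z| * xd z.2 ^ (-α)) := by ring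
        _ ≤ _ := by gcongr; exact hε z hz
    calc _ ≤ κ⁻¹ * (ε * ((ζ z) ^ 2 * (xd z.2 ^ 2)⁻¹) + C) * v z ^ 2 := by gcongr
      _ = _ := by
        rw [div_pow]
        ring
  have hdd : (d : ℝ) * (d * (κ / (2 * (d : ℝ) ^ 2) * (gradSq v z * ζ z ^ 2))) =
      κ / 2 * (gradSq v z * ζ z ^ 2) := by
    field_simp
  linarith

end caccioppoli

section energy

variable {d : ℕ} {κ α : ℝ}

set_option maxHeartbeats 1000000 in
theorem caccioppoli (hd : 1 ≤ d) (hκ : 0 < κ) (hκ1 : κ ≤ 1) (hα0 : 0 < α) (hα : α < 2)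
    {r R : ℝ} (hr : 0 < r) (h : r < R) (hR1 : R ≤ 1) :
    ∃ N, 0 < N ∧ ∀ (lam : ℝ) (w c : ℝ → ℝ) (b : Fin d → Fin d → ℝ → ℝ), 0 ≤ lam →
      Coef hd κ α w c b → ∀ v : ℝ × Ed d → ℝ, Sol α lam w c b v →
        ∫ z in Qo d α r, gradSq v z ≤ N * ∫ z in Qo d α R, v z ^ 2 ∧
        lam * ∫ z in Qo d α r, xd z.2 ^ (-α) * (v z * v z) ≤ N * ∫ z in Qo d α R, v z ^ 2 := by
  obtain ⟨ζ, M, hM, hζ, hζε⟩ := exists_cutoff d hα0 hα hr h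
  obtain ⟨C, hC0, hC⟩ := hζε (κ ^ 2 / 32) (by positivity) (by nlinarith)
  set K : ℝ := κ⁻¹ * C + d ^ 2 * ((κ / (2 * d ^ 2))⁻¹ * (κ⁻¹ * M) ^ 2) with hK
  have hK0 : 0 ≤ K := by positivity
  set K' : ℝ := K + κ * M ^ 2 / 4 with hK'
  have hK'0 : 0 < K' := by positivity
  refine ⟨4 * κ⁻¹ * K', by positivity, ?_⟩
  intro lam w c b hlam hcoef v hsol
  have hv := hsol.smooth
  have hζs := hζ.smooth
  have hR : 0 ≤ R := hr.le.trans h.le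
  have hf : ContDiff ℝ (⊤ : ℕ∞) fun z => v z * ζ z := hv.mul hζs
  have hf0 := hζ.mul_bdry hR hα hR1 hsol.bdry
  have hfs := hζ.supp_mul v
  have hf0' : ∀ z ∈ Cyl d α R, z.1 < 0 → xd z.2 = 0 → v z * ζ z = 0 := fun z _ => hf0 z
  have hv0 : ∀ z ∈ Cyl d α R, z.1 < 0 → xd z.2 = 0 → v z = 0 := fun z hz =>
    hsol.bdry z ⟨hz.1.trans_le (Real.rpow_le_rpow hR hR1 (by linarith)), hz.2.trans_le hR1⟩
  have hspace : ∀ i j, _ := fun i j => space_flux_eq_zero hcoef (R := R)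
    (g := fun z => dv (ei (innerIdx hd i j)) v z * (v z * ζ z * ζ z))
    ((contDiff_dv hv _).mul (hf.mul hζs))
    ((closure_mono fun z hz => right_ne_zero_of_mul (right_ne_zero_of_mul hz)).trans hζ.supp)
    (fun z h1 h2 => by rw [hf0 z h1 h2, zero_mul, mul_zero]) i j
  obtain ⟨htI, ht0⟩ := time_flux_nonneg hd hcoef.weight_w hκ hα hR1 hf hfs hf0'
  obtain ⟨hHI, hH⟩ := integral_sq_div_xd_le hd hf hfs hf0
  have hSI : IntegrableOn (fun z => gradSq v z * ζ z ^ 2) (Qo d α R) :=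
    integrableOn_Qo_of_continuous ((contDiff_gradSq hv).mul (hζs.pow 2)).continuous
  have hVI : IntegrableOn (fun z => v z ^ 2) (Qo d α R) :=
    integrableOn_Qo_of_continuous (hv.pow 2).continuous
  have hcI : IntegrableOn (fun z => c (xd z.2) * (v z * v z) * ζ z ^ 2) (Qo d α R) := by
    obtain ⟨-, -, h2⟩ := integrableOn_weight_mul hd hcoef.weight_c hκ hα hR1 hf hf hf0' hf0'
    refine h2.congr_fun (fun z _ => ?_) isOpen_Qo.measurableSet
    ring
  have hGI : IntegrableOn (fun z => ∑ i, ∑ j, b i j (xd z.2) * dv (ei (outerIdx hd i j))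
        (fun z => dv (ei (innerIdx hd i j)) v z * (v z * ζ z * ζ z)) z) (Qo d α R) :=
    integrable_finsetSum _ fun i _ => integrable_finsetSum _ fun j _ => (hspace i j).1
  have hG : ∫ z in Qo d α R, ∑ i, ∑ j, b i j (xd z.2) * dv (ei (outerIdx hd i j))
        (fun z => dv (ei (innerIdx hd i j)) v z * (v z * ζ z * ζ z)) z = 0 := by
    rw [integral_finsetSum _ fun i _ => integrable_finsetSum _ fun j _ => (hspace i j).1]
    refine Finset.sum_eq_zero fun i _ => ?_
    rw [integral_finsetSum _ fun j _ => (hspace i j).1]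
    exact Finset.sum_eq_zero fun j _ => (hspace i j).2
  have hpt : ∀ᵐ z ∂(volume.restrict (Qo d α R)), _ ≤ _ :=
    (ae_restrict_iff' isOpen_Qo.measurableSet).2 (hsol.eqn.mono fun z hz hzQ =>
      caccioppoli_pointwise hcoef hκ hζ hv hC hzQ (hz (Qo_mono hα hR hR1 hzQ)))
  have hint := integral_mono_ae ((hSI.const_mul (κ / 2)).add (hcI.const_mul lam))
    (((hGI.sub (htI.const_mul (1 / 2))).add (hHI.const_mul (κ⁻¹ * (κ ^ 2 / 32)))).add
      (hVI.const_mul K)) hpt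
  have e1 := integral_add (hSI.const_mul (κ / 2)) (hcI.const_mul lam)
  have e2 := integral_add ((hGI.sub (htI.const_mul (1 / 2))).add
    (hHI.const_mul (κ⁻¹ * (κ ^ 2 / 32)))) (hVI.const_mul K)
  have e3 := integral_add (hGI.sub (htI.const_mul (1 / 2))) (hHI.const_mul (κ⁻¹ * (κ ^ 2 / 32)))
  have e4 := integral_sub hGI (htI.const_mul (1 / 2))
  simp only [Pi.add_apply, Pi.sub_apply, integral_const_mul, hG] at hint e1 e2 e3 e4
  rw [e1, e2, e3, e4] at hint
  have hD : ∫ z in Qo d α R, dv (ei (lastIdx hd)) (fun z => v z * ζ z) z ^ 2 ≤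
      2 * (∫ z in Qo d α R, gradSq v z * ζ z ^ 2) +
        2 * M ^ 2 * ∫ z in Qo d α R, v z ^ 2 := by
    rw [← integral_const_mul, ← integral_const_mul,
      ← integral_add (hSI.const_mul 2) (hVI.const_mul (2 * M ^ 2))]
    refine setIntegral_mono_on
      (integrableOn_Qo_of_continuous ((contDiff_dv hf _).pow 2).continuous)
      ((hSI.const_mul 2).add (hVI.const_mul (2 * M ^ 2))) isOpen_Qo.measurableSet fun z hz => ?_
    rw [dv_mul hv hζs]
    have h1 : dv (ei (lastIdx hd)) ζ z ^ 2 ≤ M ^ 2 :=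
      sq_le_sq.2 ((hζ.space_le z hz _).trans (le_abs_self _))
    have h2 := mul_le_mul_of_nonneg_right (sq_le_gradSq v z (lastIdx hd)) (sq_nonneg (ζ z))
    have h3 := mul_le_mul_of_nonneg_right h1 (sq_nonneg (v z))
    nlinarith [sq_nonneg (dv (ei (lastIdx hd)) v z * ζ z - v z * dv (ei (lastIdx hd)) ζ z)]
  have hκκ : κ⁻¹ * (κ ^ 2 / 32) = κ / 32 := by field_simp
  rw [hκκ] at hint
  have hmain : κ / 4 * (∫ z in Qo d α R, gradSq v z * ζ z ^ 2) +
      lam * (∫ z in Qo d α R, c (xd z.2) * (v z * v z) * ζ z ^ 2) ≤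
      K' * ∫ z in Qo d α R, v z ^ 2 := by
    have := mul_le_mul_of_nonneg_left (hH.trans (mul_le_mul_of_nonneg_left hD zero_le_four))
      (by positivity : 0 ≤ κ / 32)
    rw [hK']
    nlinarith
  have hS0 : 0 ≤ ∫ z in Qo d α R, gradSq v z * ζ z ^ 2 :=
    integral_nonneg fun z => mul_nonneg (gradSq_nonneg _ _) (sq_nonneg _)
  have hc0 : 0 ≤ ∫ z in Qo d α R, c (xd z.2) * (v z * v z) * ζ z ^ 2 :=
    setIntegral_nonneg isOpen_Qo.measurableSet fun z hz =>
      mul_nonneg (mul_nonneg (hcoef.weight_c.nonneg hκ hz.2.2.2) (mul_self_nonneg _)) (sq_nonneg _)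
  have hκi : 0 < κ⁻¹ := by positivity
  have hcancel : κ⁻¹ * κ = 1 := inv_mul_cancel₀ hκ.ne'
  constructor
  · refine (setIntegral_le_of_cutoff hα hr.le h.le hζ (fun z _ => gradSq_nonneg v z) hSI).trans ?_
    have h1 : κ / 4 * (∫ z in Qo d α R, gradSq v z * ζ z ^ 2) ≤
      K' * ∫ z in Qo d α R, v z ^ 2 := by
      have := mul_nonneg hlam hc0
      linarith
    have := mul_le_mul_of_nonneg_left h1 (by positivity : 0 ≤ 4 * κ⁻¹)
    calc _ = 4 * κ⁻¹ * (κ / 4 * ∫ z in Qo d α R, gradSq v z * ζ z ^ 2) := by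
          field_simp
      _ ≤ _ := this
      _ = _ := by ring
  · have hxI : IntegrableOn (fun z => xd z.2 ^ (-α) * (v z * v z) * ζ z ^ 2) (Qo d α R) := by
      obtain ⟨-, -, h2⟩ := integrableOn_weight_mul hd (weight_rpow (α := α) hκ hκ1) hκ hα hR1
        hf hf hf0' hf0'
      refine h2.congr_fun (fun z _ => ?_) isOpen_Qo.measurableSet
      ring
    have h1 := setIntegral_le_of_cutoff hα hr.le h.le hζ (fun z hz =>
      mul_nonneg (Real.rpow_nonneg hz.2.2.2.le (-α)) (mul_self_nonneg (v z))) hxI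
    have h2 : κ * (∫ z in Qo d α R, xd z.2 ^ (-α) * (v z * v z) * ζ z ^ 2) ≤
        ∫ z in Qo d α R, c (xd z.2) * (v z * v z) * ζ z ^ 2 := by
      rw [← integral_const_mul]
      refine setIntegral_mono_on (hxI.const_mul κ) hcI isOpen_Qo.measurableSet fun z hz => ?_
      have := hcoef.weight_c.lower _ hz.2.2.2
      have h3 : 0 ≤ v z * v z * ζ z ^ 2 := mul_nonneg (mul_self_nonneg _) (sq_nonneg _)
      nlinarith
    have h3 : lam * (∫ z in Qo d α R, c (xd z.2) * (v z * v z) * ζ z ^ 2) ≤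
      K' * ∫ z in Qo d α R, v z ^ 2 := by nlinarith
    have hK0' : 0 ≤ K' * ∫ z in Qo d α R, v z ^ 2 := (mul_nonneg hlam hc0).trans h3
    calc _ ≤ lam * ∫ z in Qo d α R, xd z.2 ^ (-α) * (v z * v z) * ζ z ^ 2 := by gcongr
      _ = κ⁻¹ * (lam * (κ * ∫ z in Qo d α R, xd z.2 ^ (-α) * (v z * v z) * ζ z ^ 2)) := by
        field_simp
      _ ≤ κ⁻¹ * (K' * ∫ z in Qo d α R, v z ^ 2) := by
        exact mul_le_mul_of_nonneg_left ((mul_le_mul_of_nonneg_left h2 hlam).trans h3) hκi.le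
      _ ≤ 4 * κ⁻¹ * K' * ∫ z in Qo d α R, v z ^ 2 := by nlinarith

end energy

section time

variable {d : ℕ} {κ α lam : ℝ} {w c : ℝ → ℝ} {b : Fin d → Fin d → ℝ → ℝ}

/-- The gradients of all tangential derivatives, counted with multiplicity. -/
def tangSq (hd : 1 ≤ d) (v : ℝ × Ed d → ℝ) (z : ℝ × Ed d) : ℝ :=
  ∑ i, ∑ j, if outerIdx hd i j = lastIdx hd then 0 else gradSq (dv (ei (outerIdx hd i j)) v) z

theorem contDiff_tangSq (hd : 1 ≤ d) {v : ℝ × Ed d → ℝ} (hv : ContDiff ℝ (⊤ : ℕ∞) v) :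
    ContDiff ℝ (⊤ : ℕ∞) (tangSq hd v) := by
  refine ContDiff.sum fun i _ => ContDiff.sum fun j _ => ?_
  split_ifs
  · exact contDiff_const
  · exact contDiff_gradSq (contDiff_dv hv _)

theorem outerIdx_eq_last {hd : 1 ≤ d} {i j : Fin d} (h : outerIdx hd i j = lastIdx hd) :
    i = lastIdx hd ∧ j = lastIdx hd := by
  unfold outerIdx at h
  split_ifs at h with hi
  · exact ⟨hi, h⟩
  · exact absurd h hi

theorem sq_remainder_le {hd : 1 ≤ d} (hcoef : Coef hd κ α w c b) {v : ℝ × Ed d → ℝ}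
    (hv : ContDiff ℝ (⊤ : ℕ∞) v) {z : ℝ × Ed d} (hz : 0 < xd z.2) :
    (∑ i, ∑ j, b i j (xd z.2) * dv (ei i) (dv (ei j) v) z -
        dv (ei (lastIdx hd)) (dv (ei (lastIdx hd)) v) z) ^ 2 ≤
      d ^ 2 * (κ⁻¹ ^ 2 * tangSq hd v z) := by
  set e := lastIdx hd with he
  have h1 : ∑ i, ∑ j, b i j (xd z.2) * dv (ei i) (dv (ei j) v) z - dv (ei e) (dv (ei e) v) z =
      ∑ i, ∑ j, if outerIdx hd i j = e then 0
        else b i j (xd z.2) * dv (ei i) (dv (ei j) v) z := by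
    have h2 : dv (ei e) (dv (ei e) v) z = ∑ i, ∑ j,
        if i = e then (if j = e then dv (ei e) (dv (ei e) v) z else 0) else 0 := by
      simp
    rw [h2, ← Finset.sum_sub_distrib]
    refine Finset.sum_congr rfl fun i _ => ?_
    rw [← Finset.sum_sub_distrib]
    refine Finset.sum_congr rfl fun j _ => ?_
    by_cases h : outerIdx hd i j = e
    · obtain ⟨h3, h4⟩ := outerIdx_eq_last h
      rw [if_pos h, h3, h4, if_pos rfl, if_pos rfl, hcoef.last _ hz, one_mul, sub_self]
    · rw [if_neg h]
      have : ¬ (i = e ∧ j = e) := by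
        rintro ⟨rfl, rfl⟩
        exact h (by simp [outerIdx])
      by_cases h3 : i = e
      · rw [if_pos h3, if_neg fun h4 => this ⟨h3, h4⟩, sub_zero]
      · rw [if_neg h3, sub_zero]
  rw [h1, ← Fintype.sum_prod_type' (f := fun i j : Fin d => if outerIdx hd i j = e then (0 : ℝ)
        else b i j (xd z.2) * dv (ei i) (dv (ei j) v) z)]
  refine sq_sum_le_card_mul_sum_sq.trans ?_
  rw [tangSq, ← Fintype.sum_prod_type' (f := fun i j : Fin d => if outerIdx hd i j = e then (0 : ℝ)
        else gradSq (dv (ei (outerIdx hd i j)) v) z), Finset.mul_sum _ _ (κ⁻¹ ^ 2)]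
  have hcard : ((Finset.univ : Finset (Fin d × Fin d)).card : ℝ) = d ^ 2 := by
    simp [sq]
  rw [hcard]
  refine mul_le_mul_of_nonneg_left (Finset.sum_le_sum fun p _ => ?_) (sq_nonneg _)
  obtain ⟨i, j⟩ := p
  dsimp only
  split_ifs with h
  · simp
  · rw [mul_pow, ← dv_outer_inner hd hv i j, dv_comm hv]
    have hb : b i j (xd z.2) ^ 2 ≤ κ⁻¹ ^ 2 :=
      sq_le_sq.2 ((hcoef.bound _ hz i j).trans (le_abs_self _))
    exact mul_le_mul hb (sq_le_gradSq _ _ _) (sq_nonneg _) (sq_nonneg _)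

theorem time_pointwise {hd : 1 ≤ d} (hcoef : Coef hd κ α w c b) (hκ : 0 < κ) (hα : 0 < α)
    (hlam : 0 ≤ lam) {r R M : ℝ} (hR1 : R ≤ 1) {ζ v : ℝ × Ed d → ℝ} (hζ : Cutoff α r R M ζ)
    (hv : ContDiff ℝ (⊤ : ℕ∞) v) {z : ℝ × Ed d} (hz : z ∈ Qo d α R)
    (heq : opResidual lam w c b v z = 0) :
    κ / 2 * (dv (et d) v z ^ 2 * ζ z ^ 2) ≤
      -(lam / 2) * (c (xd z.2) * dv (et d) (fun z => (v z * ζ z) * (v z * ζ z)) z) +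
      dv (ei (lastIdx hd)) (fun z => dv (ei (lastIdx hd)) v z * (dv (et d) v z * ζ z * ζ z)) z +
      -(1 / 2) * dv (et d) (fun z => (dv (ei (lastIdx hd)) v z * ζ z) *
        (dv (ei (lastIdx hd)) v z * ζ z)) z +
      κ⁻¹ * M * lam * (xd z.2 ^ (-α) * (v z * v z)) +
      (M + 4 * κ⁻¹ * M ^ 2) * gradSq v z + κ⁻¹ * (d ^ 2 * (κ⁻¹ ^ 2 * tangSq hd v z)) := by
  have hζs := hζ.smooth
  have hx := hz.2.2.2
  have hF := sq_remainder_le hcoef hv hx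
  have hgrad := sq_le_gradSq v z (lastIdx hd)
  have hpS := contDiff_dv hv (ei (lastIdx hd))
  have hVS := contDiff_dv hv (et d)
  have hcomm := dv_comm hv (ei (lastIdx hd)) (et d)
  rw [dv_mul (hv.mul hζs) (hv.mul hζs), dv_mul hv hζs, dv_mul hpS ((hVS.mul hζs).mul hζs),
    dv_mul (hVS.mul hζs) hζs, dv_mul hVS hζs, dv_mul (hpS.mul hζs) (hpS.mul hζs),
    dv_mul hpS hζs, hcomm]
  have hMt := hζ.time_le z hz
  have hMd := hζ.space_le z hz (lastIdx hd)
  have hw := hcoef.weight_w.lower_of_le_one hκ hα hx (xd_le_one hR1 hz)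
  have hc0 := hcoef.weight_c.nonneg hκ hx
  have hcu := hcoef.weight_c.upper _ hx
  have hζ0 := hζ.nonneg z
  have hζ1 := hζ.le_one z
  have hxp : 0 ≤ xd z.2 ^ (-α) := Real.rpow_nonneg hx.le _
  have hM0 : 0 ≤ M := (abs_nonneg _).trans hMt
  unfold opResidual at heq
  set p := dv (ei (lastIdx hd)) v z
  set V := dv (et d) v z
  set A := dv (ei (lastIdx hd)) (dv (ei (lastIdx hd)) v) z
  set B := ∑ i, ∑ j, b i j (xd z.2) * dv (ei i) (dv (ei j) v) z
  set ζt := dv (et d) ζ z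
  set ζd := dv (ei (lastIdx hd)) ζ z
  set q := dv (et d) (dv (ei (lastIdx hd)) v) z
  set W := w (xd z.2)
  set c0 := c (xd z.2)
  set s := xd z.2 ^ (-α)
  set y := v z
  set f := ζ z
  set H := (d : ℝ) ^ 2 * (κ⁻¹ ^ 2 * tangSq hd v z)
  have hκi : 0 < κ⁻¹ := inv_pos.2 hκ
  have hft : |f * ζt| ≤ M := by
    rw [abs_mul, abs_of_nonneg hζ0]
    exact (mul_le_mul hζ1 hMt (abs_nonneg _) zero_le_one).trans_eq (one_mul M)
  have hc1 : c0 * (y * y) * (f * ζt) ≤ κ⁻¹ * M * (s * (y * y)) := by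
    calc c0 * (y * y) * (f * ζt) ≤ c0 * (y * y) * M :=
          mul_le_mul_of_nonneg_left ((le_abs_self _).trans hft)
            (mul_nonneg hc0 (mul_self_nonneg _))
      _ ≤ κ⁻¹ * s * (y * y) * M := by
          have := mul_self_nonneg y
          gcongr
      _ = _ := by ring
  have hc2 := mul_le_mul_of_nonneg_left hc1 hlam
  have hp1 : p ^ 2 * (f * ζt) ≤ M * p ^ 2 := by
    rw [mul_comm M]
    exact mul_le_mul_of_nonneg_left ((le_abs_self _).trans hft) (sq_nonneg _)
  have hd2 : ζd ^ 2 ≤ M ^ 2 := sq_le_sq.2 (hMd.trans (le_abs_self _))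
  have hy1 := young_neg (γ := κ / 4) (a := V * f) (x := p * ζd) (by positivity)
  have hy2 := young_neg (γ := κ / 2) (a := V * f) (x := -((B - A) * f)) (by positivity)
  have hinv1 : (κ / 4)⁻¹ = 4 * κ⁻¹ := by field_simp
  have hinv2 : (κ / 2)⁻¹ = 2 * κ⁻¹ := by field_simp
  rw [hinv1] at hy1
  rw [hinv2] at hy2
  have hpd : 4 * κ⁻¹ * (p * ζd) ^ 2 ≤ 4 * κ⁻¹ * M ^ 2 * p ^ 2 := by
    have := mul_le_mul_of_nonneg_left hd2 (sq_nonneg p)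
    have := mul_le_mul_of_nonneg_left this (by positivity : 0 ≤ 4 * κ⁻¹)
    linarith
  have hf2 : f ^ 2 ≤ 1 := pow_le_one₀ hζ0 hζ1
  have hFf : 2 * κ⁻¹ * (-((B - A) * f)) ^ 2 ≤ 2 * κ⁻¹ * H := by
    have h1 : (-((B - A) * f)) ^ 2 ≤ H := by
      have := mul_le_mul_of_nonneg_left hf2 (sq_nonneg (B - A))
      linarith
    exact mul_le_mul_of_nonneg_left h1 (by positivity)
  have hwV : κ * (V ^ 2 * f ^ 2) ≤ W * (V ^ 2 * f ^ 2) :=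
    mul_le_mul_of_nonneg_right hw (by positivity)
  have hkey : W * (V ^ 2 * f ^ 2) = (B - lam * (c0 * y)) * V * f ^ 2 := by
    have : W * V = B - lam * (c0 * y) := by linarith
    rw [← this]
    ring
  have hpg := mul_le_mul_of_nonneg_left hgrad (by positivity : 0 ≤ M + 4 * κ⁻¹ * M ^ 2)
  linarith

end time

section chain

variable {d : ℕ} {κ α : ℝ}

theorem setIntegral_sq_mono {r R : ℝ} (hα : α < 2) (hr : 0 ≤ r) (h : r ≤ R)
    {g : ℝ × Ed d → ℝ} (hg : Continuous g) (hg0 : ∀ z, 0 ≤ g z) :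
    ∫ z in Qo d α r, g z ≤ ∫ z in Qo d α R, g z :=
  setIntegral_mono_set (integrableOn_Qo_of_continuous hg)
    (Filter.Eventually.of_forall hg0) (Qo_mono hα hr h).eventuallyLE

theorem xd_ei_of_ne (hd : 1 ≤ d) {i : Fin d} (hi : i ≠ lastIdx hd) :
    xd (ei i : ℝ × Ed d).2 = 0 := xd_single_of_ne hd hi

theorem xd_et : xd (et d).2 = 0 := by
  have := xd_add_smul (0 : Ed d) 0 (1 : ℝ)
  simpa [et] using this

theorem exists_space_bound (hd : 1 ≤ d) (hκ : 0 < κ) (hκ1 : κ ≤ 1) (hα0 : 0 < α) (hα : α < 2)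
    {r R : ℝ} (hr : 0 < r) (h : r < R) (hR1 : R ≤ 1) :
    ∃ N, 0 < N ∧ ∀ (lam : ℝ) (w c : ℝ → ℝ) (b : Fin d → Fin d → ℝ → ℝ), 0 ≤ lam →
      Coef hd κ α w c b → ∀ v : ℝ × Ed d → ℝ, Sol α lam w c b v → ∀ i,
        ∫ z in Qo d α r, dv (ei i) v z ^ 2 ≤ N * ∫ z in Qo d α R, v z ^ 2 := by
  obtain ⟨N, hN, H⟩ := caccioppoli hd hκ hκ1 hα0 hα hr h hR1
  refine ⟨N, hN, fun lam w c b hlam hcoef v hv i => ?_⟩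
  refine le_trans ?_ (H lam w c b hlam hcoef v hv).1
  exact setIntegral_mono
    (integrableOn_Qo_of_continuous ((contDiff_dv hv.smooth _).pow 2).continuous)
    (integrableOn_Qo_of_continuous (contDiff_gradSq hv.smooth).continuous)
    fun z => sq_le_gradSq v z i

theorem exists_tangSq_bound (hd : 1 ≤ d) (hκ : 0 < κ) (hκ1 : κ ≤ 1) (hα0 : 0 < α) (hα : α < 2)
    {r R : ℝ} (hr : 0 < r) (h : r < R) (hR1 : R ≤ 1) :
    ∃ N, 0 < N ∧ ∀ (lam : ℝ) (w c : ℝ → ℝ) (b : Fin d → Fin d → ℝ → ℝ), 0 ≤ lam →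
      Coef hd κ α w c b → ∀ v : ℝ × Ed d → ℝ, Sol α lam w c b v →
        ∫ z in Qo d α r, tangSq hd v z ≤ N * ∫ z in Qo d α R, v z ^ 2 := by
  obtain ⟨N1, hN1, H1⟩ := caccioppoli hd hκ hκ1 hα0 hα hr
    (by linarith : r < (r + R) / 2) (by linarith)
  obtain ⟨N2, hN2, H2⟩ := exists_space_bound hd hκ hκ1 hα0 hα
    (by linarith : 0 < (r + R) / 2) (by linarith : (r + R) / 2 < R) hR1
  have hd0 : (0 : ℝ) < d := by exact_mod_cast hd
  refine ⟨d * (d * (N1 * N2)), by positivity, fun lam w c b hlam hcoef v hv => ?_⟩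
  have hV : 0 ≤ ∫ z in Qo d α R, v z ^ 2 := integral_nonneg fun z => sq_nonneg _
  have hterm : ∀ i j, IntegrableOn (fun z => if outerIdx hd i j = lastIdx hd then 0
      else gradSq (dv (ei (outerIdx hd i j)) v) z) (Qo d α r) := fun i j => by
    split_ifs
    · exact integrableOn_zero
    · exact integrableOn_Qo_of_continuous
        (contDiff_gradSq (contDiff_dv hv.smooth _)).continuous
  unfold tangSq
  rw [integral_finsetSum _ fun i _ => integrable_finsetSum _ fun j _ => hterm i j]
  have hle : ∀ i j, ∫ z in Qo d α r, (if outerIdx hd i j = lastIdx hd then 0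
      else gradSq (dv (ei (outerIdx hd i j)) v) z) ≤ N1 * N2 * ∫ z in Qo d α R, v z ^ 2 := by
    intro i j
    split_ifs with hij
    · rw [integral_zero]
      positivity
    · refine (H1 lam w c b hlam hcoef _ (hv.tangential (xd_ei_of_ne hd hij))).1.trans ?_
      rw [mul_assoc]
      exact mul_le_mul_of_nonneg_left (H2 lam w c b hlam hcoef v hv _) hN1.le
  calc _ ≤ ∑ _i : Fin d, ∑ _j : Fin d, N1 * N2 * ∫ z in Qo d α R, v z ^ 2 := by
        refine Finset.sum_le_sum fun i _ => ?_
        rw [integral_finsetSum _ fun j _ => hterm i j]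
        exact Finset.sum_le_sum fun j _ => hle i j
    _ = _ := by
        simp only [Finset.sum_const, Finset.card_univ, Fintype.card_fin, nsmul_eq_mul]
        ring

theorem time_sq_flux_nonneg {R : ℝ} {f : ℝ × Ed d → ℝ} (hf : ContDiff ℝ (⊤ : ℕ∞) f)
    (hs : tsupport f ⊆ Cyl d α R) :
    0 ≤ ∫ z in Qo d α R, dv (et d) (fun z => f z * f z) z := by
  have hff : ContDiff ℝ (⊤ : ℕ∞) fun z => f z * f z := hf.mul hf
  obtain ⟨C1, -, hC1⟩ := exists_bound_of_continuous (α := α) (R := R) hff.continuous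
  obtain ⟨C2, -, hC2⟩ := exists_bound_of_continuous (α := α) (R := R)
    (contDiff_dv hff (et d)).continuous
  have := integral_dv_time_nonneg (w := fun _ => (1 : ℝ)) (C1 := C1) (C2 := C2) (α := α) (R := R)
    measurable_const
    (fun _ _ => zero_le_one) hff ((closure_mono fun z hz => left_ne_zero_of_mul hz).trans hs)
    (fun z => mul_self_nonneg _)
    (fun z hz => by simpa using hC1 z (Qo_subset_compactCyl hz))
    (fun z hz => by simpa using hC2 z (Qo_subset_compactCyl hz))
  simpa using this

set_option maxHeartbeats 1000000 in
theorem exists_time_bound (hd : 1 ≤ d) (hκ : 0 < κ) (hκ1 : κ ≤ 1) (hα0 : 0 < α) (hα : α < 2)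
    {r R : ℝ} (hr : 0 < r) (h : r < R) (hR1 : R ≤ 1) :
    ∃ N, 0 < N ∧ ∀ (lam : ℝ) (w c : ℝ → ℝ) (b : Fin d → Fin d → ℝ → ℝ), 0 ≤ lam →
      Coef hd κ α w c b → ∀ v : ℝ × Ed d → ℝ, Sol α lam w c b v →
        ∫ z in Qo d α r, dv (et d) v z ^ 2 ≤ N * ∫ z in Qo d α R, v z ^ 2 := by
  set ρ : ℝ := (r + R) / 2 with hρ
  have hrρ : r < ρ := by rw [hρ]; linarith
  have hρR : ρ < R := by rw [hρ]; linarith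
  have hρ0 : 0 < ρ := hr.trans hrρ
  have hρ1 : ρ ≤ 1 := hρR.le.trans hR1
  obtain ⟨N1, hN1, H1⟩ := caccioppoli hd hκ hκ1 hα0 hα hρ0 hρR hR1
  obtain ⟨N2, hN2, H2⟩ := exists_tangSq_bound hd hκ hκ1 hα0 hα hρ0 hρR hR1
  obtain ⟨ζ, M, hM, hζ, -⟩ := exists_cutoff d hα0 hα hr hrρ
  have hM0 : 0 < M := by linarith
  refine ⟨2 * κ⁻¹ * (κ⁻¹ * M * N1 + (M + 4 * κ⁻¹ * M ^ 2) * N1 +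
    κ⁻¹ * (d ^ 2 * (κ⁻¹ ^ 2 * N2))), by positivity, ?_⟩
  intro lam w c b hlam hcoef v hsol
  have hv := hsol.smooth
  have hζs := hζ.smooth
  have hp := contDiff_dv hv (ei (lastIdx hd))
  have hV := contDiff_dv hv (et d)
  have hf : ContDiff ℝ (⊤ : ℕ∞) fun z => v z * ζ z := hv.mul hζs
  have hf0 := hζ.mul_bdry hρ0.le hα hρ1 hsol.bdry
  have hV0 := hζ.mul_bdry hρ0.le hα hρ1 (hsol.tangential (e := et d) xd_et).bdry
  obtain ⟨htI, ht0⟩ := time_flux_nonneg hd hcoef.weight_c hκ hα hρ1 hf (hζ.supp_mul v)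
    fun z _ => hf0 z
  have hg : ContDiff ℝ (⊤ : ℕ∞) fun z =>
      dv (ei (lastIdx hd)) v z * (dv (et d) v z * ζ z * ζ z) := hp.mul ((hV.mul hζs).mul hζs)
  have hgI : IntegrableOn (dv (ei (lastIdx hd)) fun z =>
      dv (ei (lastIdx hd)) v z * (dv (et d) v z * ζ z * ζ z)) (Qo d α ρ) :=
    integrableOn_Qo_of_continuous (contDiff_dv hg _).continuous
  have hg0 := integral_dv_last hd hg
    ((closure_mono fun z hz => right_ne_zero_of_mul (right_ne_zero_of_mul hz)).trans hζ.supp)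
    fun z h1 h2 => by rw [hV0 z h1 h2, zero_mul, mul_zero]
  have hpζ : ContDiff ℝ (⊤ : ℕ∞) fun z => dv (ei (lastIdx hd)) v z * ζ z := hp.mul hζs
  have hpp0 := time_sq_flux_nonneg hpζ (hζ.supp_mul _)
  have hppI : IntegrableOn (dv (et d) fun z => (dv (ei (lastIdx hd)) v z * ζ z) *
      (dv (ei (lastIdx hd)) v z * ζ z)) (Qo d α ρ) :=
    integrableOn_Qo_of_continuous (contDiff_dv (hpζ.mul hpζ) _).continuous
  have hxI : IntegrableOn (fun z => xd z.2 ^ (-α) * (v z * v z)) (Qo d α ρ) := by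
    have hv0 : ∀ z ∈ Cyl d α ρ, z.1 < 0 → xd z.2 = 0 → v z = 0 := fun z hz =>
      hsol.bdry z ⟨hz.1.trans_le (Real.rpow_le_rpow hρ0.le hρ1 (by linarith)),
        hz.2.trans_le hρ1⟩
    obtain ⟨-, -, h2⟩ := integrableOn_weight_mul hd (weight_rpow (α := α) hκ hκ1) hκ hα hρ1
      hv hv hv0 hv0
    exact h2
  have hSI : IntegrableOn (gradSq v) (Qo d α ρ) :=
    integrableOn_Qo_of_continuous (contDiff_gradSq hv).continuous
  have hTI : IntegrableOn (tangSq hd v) (Qo d α ρ) :=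
    integrableOn_Qo_of_continuous (contDiff_tangSq hd hv).continuous
  have hLI : IntegrableOn (fun z => dv (et d) v z ^ 2 * ζ z ^ 2) (Qo d α ρ) :=
    integrableOn_Qo_of_continuous ((hV.pow 2).mul (hζs.pow 2)).continuous
  have hpt : ∀ᵐ z ∂(volume.restrict (Qo d α ρ)), _ ≤ _ :=
    (ae_restrict_iff' isOpen_Qo.measurableSet).2 (hsol.eqn.mono fun z hz hzQ =>
      time_pointwise hcoef hκ hα0 hlam hρ1 hζ hv hzQ (hz (Qo_mono hα hρ0.le hρ1 hzQ)))
  have i1 := (htI.const_mul (-(lam / 2))).add hgI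
  have i2 := i1.add (hppI.const_mul (-(1 / 2)))
  have i3 := i2.add (hxI.const_mul (κ⁻¹ * M * lam))
  have i4 := i3.add (hSI.const_mul (M + 4 * κ⁻¹ * M ^ 2))
  have i5 := ((hTI.const_mul (κ⁻¹ ^ 2)).const_mul ((d : ℝ) ^ 2)).const_mul κ⁻¹
  have hint := integral_mono_ae (hLI.const_mul (κ / 2)) (i4.add i5) hpt
  have e5 := integral_add i4 i5
  have e4 := integral_add i3 (hSI.const_mul (M + 4 * κ⁻¹ * M ^ 2))
  have e3 := integral_add i2 (hxI.const_mul (κ⁻¹ * M * lam))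
  have e2 := integral_add i1 (hppI.const_mul (-(1 / 2)))
  have e1 := integral_add (htI.const_mul (-(lam / 2))) hgI
  simp only [Pi.add_apply, integral_const_mul, hg0] at hint e1 e2 e3 e4 e5
  rw [e5, e4, e3, e2, e1] at hint
  obtain ⟨hS, hX⟩ := H1 lam w c b hlam hcoef v hsol
  have hT := H2 lam w c b hlam hcoef v hsol
  have hκi : 0 < κ⁻¹ := inv_pos.2 hκ
  have b2 : 0 ≤ lam / 2 *
      ∫ z in Qo d α ρ, c (xd z.2) * dv (et d) (fun z => (v z * ζ z) * (v z * ζ z)) z :=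
    mul_nonneg (by linarith) ht0
  have b3 := mul_le_mul_of_nonneg_left hX (by positivity : 0 ≤ κ⁻¹ * M)
  have b4 := mul_le_mul_of_nonneg_left hS (by positivity : 0 ≤ M + 4 * κ⁻¹ * M ^ 2)
  have b5 := mul_le_mul_of_nonneg_left hT (by positivity : 0 ≤ κ⁻¹ * ((d : ℝ) ^ 2 * κ⁻¹ ^ 2))
  have hmain : κ / 2 * ∫ z in Qo d α ρ, dv (et d) v z ^ 2 * ζ z ^ 2 ≤
      (κ⁻¹ * M * N1 + (M + 4 * κ⁻¹ * M ^ 2) * N1 + κ⁻¹ * (d ^ 2 * (κ⁻¹ ^ 2 * N2))) *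
        ∫ z in Qo d α R, v z ^ 2 := by
    linarith
  refine (setIntegral_le_of_cutoff hα hr.le hrρ.le hζ (fun z _ => sq_nonneg _) hLI).trans ?_
  have := mul_le_mul_of_nonneg_left hmain (by positivity : 0 ≤ 2 * κ⁻¹)
  calc _ = 2 * κ⁻¹ * (κ / 2 * ∫ z in Qo d α ρ, dv (et d) v z ^ 2 * ζ z ^ 2) := by
        field_simp
    _ ≤ _ := this
    _ = _ := by ring

theorem Sol.iterate_time {lam : ℝ} {w c : ℝ → ℝ} {b : Fin d → Fin d → ℝ → ℝ}
    {v : ℝ × Ed d → ℝ} (hv : Sol α lam w c b v) (k : ℕ) :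
    Sol α lam w c b ((dv (et d))^[k] v) := by
  induction k with
  | zero => exact hv
  | succ k ih =>
    rw [Function.iterate_succ_apply']
    exact ih.tangential xd_et

theorem Sol.foldr_space (hd : 1 ≤ d) {lam : ℝ} {w c : ℝ → ℝ} {b : Fin d → Fin d → ℝ → ℝ}
    {v : ℝ × Ed d → ℝ} (hv : Sol α lam w c b v) {L : List (Fin d)}
    (hL : ∀ i ∈ L, i ≠ lastIdx hd) :
    Sol α lam w c b (L.foldr (fun i f => dv (ei i) f) v) := by
  induction L with
  | nil => exact hv
  | cons i L ih =>
    rw [List.foldr_cons]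
    exact (ih fun i hi => hL i (List.mem_cons_of_mem _ hi)).tangential
      (xd_ei_of_ne hd (hL i List.mem_cons_self))

theorem exists_foldr_bound (hd : 1 ≤ d) (hκ : 0 < κ) (hκ1 : κ ≤ 1) (hα0 : 0 < α) (hα : α < 2)
    (j : ℕ) : ∀ {r R : ℝ}, 0 < r → r < R → R ≤ 1 →
    ∃ N, 0 < N ∧ ∀ (lam : ℝ) (w c : ℝ → ℝ) (b : Fin d → Fin d → ℝ → ℝ), 0 ≤ lam →
      Coef hd κ α w c b → ∀ v : ℝ × Ed d → ℝ, Sol α lam w c b v → ∀ L : List (Fin d),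
        L.length = j → (∀ i ∈ L, i ≠ lastIdx hd) →
        ∫ z in Qo d α r, (L.foldr (fun i f => dv (ei i) f) v) z ^ 2 ≤
          N * ∫ z in Qo d α R, v z ^ 2 := by
  induction j with
  | zero =>
    intro r R hr h _
    refine ⟨1, one_pos, fun lam w c b _ _ v hv L hL _ => ?_⟩
    rw [List.eq_nil_of_length_eq_zero hL, one_mul]
    exact setIntegral_sq_mono hα hr.le h.le (hv.smooth.pow 2).continuous fun z => sq_nonneg _
  | succ j ih =>
    intro r R hr h hR1
    obtain ⟨N1, hN1, H1⟩ := exists_space_bound hd hκ hκ1 hα0 hα hr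
      (by linarith : r < (r + R) / 2) (by linarith)
    obtain ⟨N2, hN2, H2⟩ := ih (by linarith : 0 < (r + R) / 2)
      (by linarith : (r + R) / 2 < R) hR1
    refine ⟨N1 * N2, by positivity, fun lam w c b hlam hcoef v hv L hL hL' => ?_⟩
    cases L with
    | nil => simp at hL
    | cons i L =>
      have hL1 : ∀ i ∈ L, i ≠ lastIdx hd := fun i hi => hL' i (List.mem_cons_of_mem _ hi)
      rw [List.foldr_cons, mul_assoc]
      exact (H1 lam w c b hlam hcoef _ (hv.foldr_space hd hL1) i).trans
        (mul_le_mul_of_nonneg_left (H2 lam w c b hlam hcoef v hv L (by simpa using hL) hL1)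
          hN1.le)

theorem exists_iterate_bound (hd : 1 ≤ d) (hκ : 0 < κ) (hκ1 : κ ≤ 1) (hα0 : 0 < α) (hα : α < 2)
    (k : ℕ) : ∀ {r R : ℝ}, 0 < r → r < R → R ≤ 1 →
    ∃ N, 0 < N ∧ ∀ (lam : ℝ) (w c : ℝ → ℝ) (b : Fin d → Fin d → ℝ → ℝ), 0 ≤ lam →
      Coef hd κ α w c b → ∀ v : ℝ × Ed d → ℝ, Sol α lam w c b v →
        ∫ z in Qo d α r, ((dv (et d))^[k] v) z ^ 2 ≤ N * ∫ z in Qo d α R, v z ^ 2 := by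
  induction k with
  | zero =>
    intro r R hr h _
    refine ⟨1, one_pos, fun lam w c b _ _ v hv => ?_⟩
    rw [one_mul]
    exact setIntegral_sq_mono hα hr.le h.le (hv.smooth.pow 2).continuous fun z => sq_nonneg _
  | succ k ih =>
    intro r R hr h hR1
    obtain ⟨N1, hN1, H1⟩ := exists_time_bound hd hκ hκ1 hα0 hα hr
      (by linarith : r < (r + R) / 2) (by linarith)
    obtain ⟨N2, hN2, H2⟩ := ih (by linarith : 0 < (r + R) / 2)
      (by linarith : (r + R) / 2 < R) hR1
    refine ⟨N1 * N2, by positivity, fun lam w c b hlam hcoef v hv => ?_⟩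
    rw [Function.iterate_succ_apply', mul_assoc]
    exact (H1 lam w c b hlam hcoef _ (hv.iterate_time k)).trans
      (mul_le_mul_of_nonneg_left (H2 lam w c b hlam hcoef v hv) hN1.le)

theorem dv_foldr {v : ℝ × Ed d → ℝ} (hv : ContDiff ℝ (⊤ : ℕ∞) v) (e : ℝ × Ed d)
    (L : List (Fin d)) :
    ContDiff ℝ (⊤ : ℕ∞) (L.foldr (fun i f => dv (ei i) f) v) ∧
      L.foldr (fun i f => dv (ei i) f) (dv e v) =
        dv e (L.foldr (fun i f => dv (ei i) f) v) := by
  induction L with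
  | nil => exact ⟨hv, rfl⟩
  | cons i L ih =>
    simp only [List.foldr_cons]
    exact ⟨contDiff_dv ih.1 _, by rw [ih.2, dv_comm ih.1]⟩

theorem dv_iterate {v : ℝ × Ed d → ℝ} (hv : ContDiff ℝ (⊤ : ℕ∞) v) (e e' : ℝ × Ed d) (k : ℕ) :
    ContDiff ℝ (⊤ : ℕ∞) ((dv e')^[k] v) ∧ (dv e')^[k] (dv e v) = dv e ((dv e')^[k] v) := by
  induction k with
  | zero => exact ⟨hv, rfl⟩
  | succ k ih =>
    simp only [Function.iterate_succ_apply']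
    exact ⟨contDiff_dv ih.1 _, by rw [ih.2, dv_comm ih.1]⟩

/-- Interior estimate for all admissible mixed derivatives of globally smooth functions. -/
theorem exists_derivative_bound (hd : 1 ≤ d) (hκ : 0 < κ) (hκ1 : κ ≤ 1) (hα0 : 0 < α)
    (hα : α < 2) (k j l : ℕ) (hl : l ≤ 1) :
    ∃ N, 0 < N ∧ ∀ (lam : ℝ) (w c : ℝ → ℝ) (b : Fin d → Fin d → ℝ → ℝ), 0 ≤ lam →
      Coef hd κ α w c b → ∀ v : ℝ × Ed d → ℝ, Sol α lam w c b v → ∀ L : List (Fin d),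
        L.length = j → (∀ i ∈ L, i ≠ lastIdx hd) →
        ∫ z in Qo d α (1 / 2), ((dv (et d))^[k] (L.foldr (fun i f => dv (ei i) f)
            ((dv (ei (lastIdx hd)))^[l] v))) z ^ 2 ≤
          N * ∫ z in Qo d α 1, v z ^ 2 := by
  obtain ⟨N1, hN1, H1⟩ := exists_space_bound (r := 1 / 2) (R := 5 / 8) hd hκ hκ1 hα0 hα
    (by norm_num) (by norm_num) (by norm_num)
  obtain ⟨N2, hN2, H2⟩ := exists_iterate_bound hd hκ hκ1 hα0 hα k (r := 5 / 8) (R := 3 / 4)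
    (by norm_num) (by norm_num) (by norm_num)
  obtain ⟨N3, hN3, H3⟩ := exists_foldr_bound hd hκ hκ1 hα0 hα j (r := 3 / 4) (R := 1)
    (by norm_num) (by norm_num) le_rfl
  refine ⟨(1 + N1) * (N2 * N3), by positivity, fun lam w c b hlam hcoef v hv L hL hL' => ?_⟩
  have hf := hv.foldr_space hd hL'
  have hk := hf.iterate_time k
  have h23 : ∫ z in Qo d α (5 / 8), ((dv (et d))^[k] (L.foldr (fun i f => dv (ei i) f) v)) z ^ 2 ≤
      N2 * (N3 * ∫ z in Qo d α 1, v z ^ 2) :=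
    (H2 lam w c b hlam hcoef _ hf).trans
      (mul_le_mul_of_nonneg_left (H3 lam w c b hlam hcoef v hv L hL hL') hN2.le)
  have h0 : 0 ≤ ∫ z in Qo d α (5 / 8),
      ((dv (et d))^[k] (L.foldr (fun i f => dv (ei i) f) v)) z ^ 2 :=
    integral_nonneg fun z => sq_nonneg _
  have hone : (1 + N1) * ∫ z in Qo d α (5 / 8),
      ((dv (et d))^[k] (L.foldr (fun i f => dv (ei i) f) v)) z ^ 2 ≤
      (1 + N1) * (N2 * N3) * ∫ z in Qo d α 1, v z ^ 2 := by
    refine (mul_le_mul_of_nonneg_left h23 (by positivity)).trans_eq (by ring)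
  refine le_trans ?_ hone
  rw [add_mul, one_mul]
  interval_cases l
  · rw [Function.iterate_zero_apply]
    refine (setIntegral_sq_mono hα (by norm_num) (by norm_num) (hk.smooth.pow 2).continuous
      fun z => sq_nonneg _ : _ ≤ ∫ z in Qo d α (5 / 8), _).trans ?_
    exact le_add_of_nonneg_right (mul_nonneg hN1.le h0)
  · rw [Function.iterate_one, (dv_foldr hv.smooth _ L).2, (dv_iterate hf.smooth _ _ k).2]
    exact (H1 lam w c b hlam hcoef _ hk _).trans (le_add_of_nonneg_left h0)

end chain

section reduction

variable {d : ℕ} {α ν : ℝ}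

theorem td_eqOn {f g : ℝ × Ed d → ℝ} {O : Set (ℝ × Ed d)} (hO : IsOpen O) (h : EqOn f g O) :
    EqOn (td f) (td g) O := by
  intro z hz
  refine Filter.EventuallyEq.deriv_eq ?_
  have hc : Continuous fun s : ℝ => (s, z.2) := by fun_prop
  filter_upwards [hc.continuousAt.preimage_mem_nhds (hO.mem_nhds hz)] with s hs
  exact h hs

theorem Du_eqOn {f g : ℝ × Ed d → ℝ} {O : Set (ℝ × Ed d)} (hO : IsOpen O) (h : EqOn f g O) :
    EqOn (Du f) (Du g) O := by
  intro z hz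
  refine Filter.EventuallyEq.fderiv_eq ?_
  have hc : Continuous fun y : Ed d => (z.1, y) := by fun_prop
  filter_upwards [hc.continuousAt.preimage_mem_nhds (hO.mem_nhds hz)] with s hs
  exact h hs

theorem pd_eqOn {f g : ℝ × Ed d → ℝ} {O : Set (ℝ × Ed d)} (hO : IsOpen O) (h : EqOn f g O)
    (i : Fin d) : EqOn (pd i f) (pd i g) O := fun z hz => by
  unfold pd
  rw [Du_eqOn hO h hz]

theorem D2u_eqOn {f g : ℝ × Ed d → ℝ} {O : Set (ℝ × Ed d)} (hO : IsOpen O) (h : EqOn f g O) :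
    EqOn (D2u f) (D2u g) O := by
  intro z hz
  refine Filter.EventuallyEq.fderiv_eq ?_
  have hc : Continuous fun y : Ed d => (z.1, y) := by fun_prop
  filter_upwards [hc.continuousAt.preimage_mem_nhds (hO.mem_nhds hz)] with s hs
  exact Du_eqOn hO h hs

theorem iterate_td_eqOn {f g : ℝ × Ed d → ℝ} {O : Set (ℝ × Ed d)} (hO : IsOpen O)
    (h : EqOn f g O) (k : ℕ) : EqOn (td^[k] f) (td^[k] g) O := by
  induction k with
  | zero => exact h
  | succ k ih =>
    simp only [Function.iterate_succ_apply']
    exact td_eqOn hO ih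

theorem iterate_pd_eqOn {f g : ℝ × Ed d → ℝ} {O : Set (ℝ × Ed d)} (hO : IsOpen O)
    (h : EqOn f g O) (i : Fin d) (k : ℕ) : EqOn ((pd i)^[k] f) ((pd i)^[k] g) O := by
  induction k with
  | zero => exact h
  | succ k ih =>
    simp only [Function.iterate_succ_apply']
    exact pd_eqOn hO ih i

theorem foldr_pd_eqOn {f g : ℝ × Ed d → ℝ} {O : Set (ℝ × Ed d)} (hO : IsOpen O)
    (h : EqOn f g O) (L : List (Fin d)) : EqOn (L.foldr pd f) (L.foldr pd g) O := by
  induction L with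
  | nil => exact h
  | cons i L ih => exact pd_eqOn hO ih i

theorem iterate_pd_eq_dv {f : ℝ × Ed d → ℝ} (hf : ContDiff ℝ (⊤ : ℕ∞) f) (i : Fin d) (k : ℕ) :
    (pd i)^[k] f = (dv (ei i))^[k] f := by
  induction k with
  | zero => rfl
  | succ k ih =>
    simp only [Function.iterate_succ_apply']
    rw [ih, pd_eq_dv (dv_iterate hf 0 _ k).1]

theorem iterate_td_eq_dv {f : ℝ × Ed d → ℝ} (hf : ContDiff ℝ (⊤ : ℕ∞) f) (k : ℕ) :
    td^[k] f = (dv (et d))^[k] f := by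
  induction k with
  | zero => rfl
  | succ k ih =>
    simp only [Function.iterate_succ_apply']
    rw [ih, td_eq_dv (dv_iterate hf 0 _ k).1]

theorem foldr_pd_eq_dv {f : ℝ × Ed d → ℝ} (hf : ContDiff ℝ (⊤ : ℕ∞) f) (L : List (Fin d)) :
    L.foldr pd f = L.foldr (fun i f => dv (ei i) f) f := by
  induction L with
  | nil => rfl
  | cons i L ih =>
    simp only [List.foldr_cons]
    rw [ih, pd_eq_dv (dv_foldr hf 0 L).1]

theorem contDiff_mul_cutoff {χ u : ℝ × Ed d → ℝ} {U : Set (ℝ × Ed d)} (hU : IsOpen U)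
    (hχ : ContDiff ℝ (⊤ : ℕ∞) χ) (hs : tsupport χ ⊆ U) (hu : ContDiffOn ℝ (⊤ : ℕ∞) u U) :
    ContDiff ℝ (⊤ : ℕ∞) fun z => χ z * u z := by
  refine contDiff_iff_contDiffAt.2 fun z => ?_
  by_cases hz : z ∈ U
  · exact hχ.contDiffAt.mul (hu.contDiffAt (hU.mem_nhds hz))
  · have h0 : χ =ᶠ[nhds z] 0 := notMem_tsupport_iff_eventuallyEq.1 fun h => hz (hs h)
    refine (contDiffAt_const (c := (0 : ℝ))).congr_of_eventuallyEq ?_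
    filter_upwards [h0] with y hy
    rw [hy, Pi.zero_apply, zero_mul]

theorem mem_closure_Qo (hd : 1 ≤ d) {R : ℝ} {z : ℝ × Ed d} (hz : z ∈ Cyl d α R) (h1 : z.1 < 0)
    (h2 : xd z.2 = 0) : z ∈ closure (Qo d α R) := by
  have hc : Filter.Tendsto (fun r : ℝ => z + r • (ei (lastIdx hd) : ℝ × Ed d))
      (nhdsWithin 0 (Ioi 0)) (nhds z) := by
    have : Filter.Tendsto (fun r : ℝ => z + r • (ei (lastIdx hd) : ℝ × Ed d)) (nhds 0)
        (nhds z) := by simpa using (continuous_line z (ei (lastIdx hd))).tendsto 0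
    exact this.mono_left nhdsWithin_le_nhds
  refine mem_closure_of_tendsto hc ?_
  filter_upwards [hc (isOpen_Cyl.mem_nhds hz), self_mem_nhdsWithin] with r hr hr0
  have hx : xd (z + r • (ei (lastIdx hd) : ℝ × Ed d)).2 = r := by
    simp [xd_add_smul, h2, ei, xd_single_last hd]
  have ht : (z + r • (ei (lastIdx hd) : ℝ × Ed d)).1 = z.1 := by simp [ei]
  refine ⟨?_, by rwa [ht], hr.2, by rw [hx]; exact hr0⟩
  exact (abs_lt.1 hr.1).1

theorem CoeffOK.diag {μc a0 c0 : ℝ → ℝ} {aij : Fin d → Fin d → ℝ → ℝ}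
    (h : CoeffOK d ν α μc a0 c0 aij) {s : ℝ} (hs : 0 < s) (i : Fin d) : ν ≤ aij i i s := by
  have := h.2.2.2.2.2.1 s hs (Pi.single i 1)
  simpa [Pi.single_apply] using this

theorem CoeffOK.weight_div {μc a0 c0 a m : ℝ → ℝ} {aij : Fin d → Fin d → ℝ → ℝ}
    (h : CoeffOK d ν α μc a0 c0 aij) (hν : 0 < ν) (ha : Measurable a) (hm : Measurable m)
    (ha1 : ∀ s, 0 < s → a s ∈ Icc ν ν⁻¹) (hm1 : ∀ s, 0 < s → m s ∈ Icc ν ν⁻¹) :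
    Weight (ν ^ 3) α fun s => a s / (μc s * m s) where
  meas := ha.div (h.1.mul hm)
  lower s hs := by
    have hp : 0 < s ^ α := Real.rpow_pos_of_pos hs _
    obtain ⟨h1, h2⟩ := (h.2.2.2.2.1 s hs).2.2
    obtain ⟨h3, h4⟩ := ha1 s hs
    obtain ⟨h5, h6⟩ := hm1 s hs
    rw [le_div_iff₀ hp] at h1
    rw [div_le_iff₀ hp] at h2
    have hμ : 0 < μc s := lt_of_lt_of_le (by positivity) h1
    have hm0 : 0 < m s := hν.trans_le h5
    rw [Real.rpow_neg hs.le, le_div_iff₀ (by positivity)]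
    calc ν ^ 3 * (s ^ α)⁻¹ * (μc s * m s) ≤ ν ^ 3 * (s ^ α)⁻¹ * ((ν⁻¹ * s ^ α) * ν⁻¹) := by
          gcongr
      _ = ν := by field_simp
      _ ≤ a s := h3
  upper s hs := by
    have hp : 0 < s ^ α := Real.rpow_pos_of_pos hs _
    obtain ⟨h1, h2⟩ := (h.2.2.2.2.1 s hs).2.2
    obtain ⟨h3, h4⟩ := ha1 s hs
    obtain ⟨h5, h6⟩ := hm1 s hs
    rw [le_div_iff₀ hp] at h1
    have hμ : 0 < μc s := lt_of_lt_of_le (by positivity) h1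
    have hm0 : 0 < m s := hν.trans_le h5
    rw [Real.rpow_neg hs.le, div_le_iff₀ (by positivity)]
    calc a s ≤ ν⁻¹ := h4
      _ = (ν ^ 3)⁻¹ * (s ^ α)⁻¹ * ((ν * s ^ α) * ν) := by field_simp
      _ ≤ _ := by gcongr

theorem CoeffOK.coef {hd : 1 ≤ d} {μc a0 c0 : ℝ → ℝ} {aij : Fin d → Fin d → ℝ → ℝ}
    (h : CoeffOK d ν α μc a0 c0 aij) (hν : 0 < ν) (hν1 : ν < 1) :
    Coef hd (ν ^ 3) α (fun s => a0 s / (μc s * aij (lastIdx hd) (lastIdx hd) s))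
      (fun s => c0 s / (μc s * aij (lastIdx hd) (lastIdx hd) s))
      (fun i j s => aij i j s / aij (lastIdx hd) (lastIdx hd) s) := by
  have hlow := fun s (hs : 0 < s) => h.diag hs (lastIdx hd)
  have hm : ∀ s, 0 < s → aij (lastIdx hd) (lastIdx hd) s ∈ Icc ν ν⁻¹ := fun s hs =>
    ⟨hlow s hs, (le_abs_self _).trans (h.2.2.2.2.2.2 s hs _ _)⟩
  have hmeas := h.2.2.2.1
  refine ⟨h.weight_div hν h.2.1 (hmeas _ _) (fun s hs => (h.2.2.2.2.1 s hs).1) hm,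
    h.weight_div hν h.2.2.1 (hmeas _ _) (fun s hs => (h.2.2.2.2.1 s hs).2.1) hm,
    fun i j => (hmeas i j).div (hmeas _ _),
    fun s hs => div_self (hν.trans_le (hlow s hs)).ne', fun s hs i j => ?_, fun s hs ξ => ?_⟩
  · have h1 := h.2.2.2.2.2.2 s hs i j
    have h2 := hν.trans_le (hlow s hs)
    rw [abs_div, abs_of_pos h2, div_le_iff₀ h2]
    calc _ ≤ ν⁻¹ := h1
      _ = (ν ^ 2)⁻¹ * ν := by field_simp
      _ ≤ (ν ^ 3)⁻¹ * aij (lastIdx hd) (lastIdx hd) s := by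
        gcongr ?_ * ?_
        · exact inv_anti₀ (by positivity) (pow_le_pow_of_le_one hν.le hν1.le (by norm_num))
        · exact hlow s hs
  · have h1 := h.2.2.2.2.2.1 s hs ξ
    have h2 := hν.trans_le (hlow s hs)
    have h3 : ∑ i, ∑ j, aij i j s / aij (lastIdx hd) (lastIdx hd) s * ξ i * ξ j =
        (∑ i, ∑ j, aij i j s * ξ i * ξ j) / aij (lastIdx hd) (lastIdx hd) s := by
      simp_rw [Finset.sum_div]
      refine Finset.sum_congr rfl fun i _ => Finset.sum_congr rfl fun j _ => by ring
    rw [h3, le_div_iff₀ h2]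
    have hS : 0 ≤ ∑ i, ξ i ^ 2 := Finset.sum_nonneg fun _ _ => sq_nonneg _
    calc ν ^ 3 * (∑ i, ξ i ^ 2) * aij (lastIdx hd) (lastIdx hd) s
        ≤ ν ^ 3 * (∑ i, ξ i ^ 2) * ν⁻¹ := by
          gcongr
          exact (hm s hs).2
      _ = ν * (ν * ∑ i, ξ i ^ 2) := by field_simp
      _ ≤ 1 * (ν * ∑ i, ξ i ^ 2) := by gcongr
      _ ≤ _ := by rwa [one_mul]

theorem sol_of_eqOn {hd : 1 ≤ d} {lam : ℝ} {μc a0 c0 : ℝ → ℝ} {aij : Fin d → Fin d → ℝ → ℝ}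
    (h : CoeffOK d ν α μc a0 c0 aij) (hν : 0 < ν) {u v : ℝ × Ed d → ℝ}
    (hv : ContDiff ℝ (⊤ : ℕ∞) v) (huv : EqOn u v (closure (Qo d α 1)))
    (hb : ∀ z ∈ closure (Qo d α 1), xd z.2 = 0 → u z = 0)
    (heq : ∀ᵐ z ∂(volume.restrict (Qo d α 1)),
            a0 (xd z.2) * ut u z + lam * c0 (xd z.2) * u z -
                μc (xd z.2) * ∑ i, ∑ j', aij i j' (xd z.2) *
                  D2u u z (EuclideanSpace.single i 1) (EuclideanSpace.single j' 1)
                = 0) :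
    Sol α lam (fun s => a0 s / (μc s * aij (lastIdx hd) (lastIdx hd) s))
      (fun s => c0 s / (μc s * aij (lastIdx hd) (lastIdx hd) s))
      (fun i j s => aij i j s / aij (lastIdx hd) (lastIdx hd) s) v where
  smooth := hv
  bdry z hz h1 h2 := by
    have hz' := mem_closure_Qo hd hz h1 h2
    rw [← huv hz', hb z hz' h2]
  eqn := by
    rw [ae_restrict_iff' isOpen_Qo.measurableSet] at heq
    filter_upwards [heq] with z hz hzQ
    have hz := hz hzQ
    have huv' := huv.mono subset_closure
    have e1 : ut u z = dv (et d) v z := by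
      rw [← td_eq_dv hv]
      exact td_eqOn isOpen_Qo huv' hzQ
    have hx := hzQ.2.2.2
    have hp : 0 < xd z.2 ^ α := Real.rpow_pos_of_pos hx _
    have ha : 0 < aij (lastIdx hd) (lastIdx hd) (xd z.2) := hν.trans_le (h.diag hx _)
    have hμ : 0 < μc (xd z.2) := by
      have := (h.2.2.2.2.1 _ hx).2.2.1
      rw [le_div_iff₀ hp] at this
      exact lt_of_lt_of_le (by positivity) this
    rw [e1, huv' hzQ, D2u_eqOn isOpen_Qo huv' hzQ] at hz
    simp_rw [D2u_eq_dv hv] at hz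
    unfold opResidual
    have e2 : ∑ i, ∑ j, aij i j (xd z.2) / aij (lastIdx hd) (lastIdx hd) (xd z.2) *
        dv (ei i) (dv (ei j) v) z =
        (∑ i, ∑ j, aij i j (xd z.2) * dv (ei i) (dv (ei j) v) z) /
          aij (lastIdx hd) (lastIdx hd) (xd z.2) := by
      simp_rw [Finset.sum_div]
      refine Finset.sum_congr rfl fun i _ => Finset.sum_congr rfl fun j _ => by ring
    rw [e2]
    field_simp
    linarith

theorem lintegral_sq_eq {R : ℝ} {g : ℝ × Ed d → ℝ} (hg : Continuous g) :
    ∫⁻ z in Qo d α R, ENNReal.ofReal (g z ^ 2) = ENNReal.ofReal (∫ z in Qo d α R, g z ^ 2) :=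
  (ofReal_integral_eq_lintegral_ofReal (integrableOn_Qo_of_continuous (hg.pow 2))
    (Filter.Eventually.of_forall fun z => sq_nonneg (g z))).symm

end reduction

/-- Lemma 3.3 (Caccioppoli-type estimate): for a smooth solution of the
homogeneous equation `𝓛₀ u = 0` in `Q₁⁺` vanishing on `{x_d = 0}`,
`∫_{Q_{1/2}⁺} |∂_t^k D_{x'}^j D_d^l u|² dz ≤ N ∫_{Q₁⁺} u² dz`. -/
theorem stmt11 (d : ℕ) (hd : 1 ≤ d) (ν α : ℝ)
    (hν : ν ∈ Set.Ioo (0 : ℝ) 1) (hα : α ∈ Set.Ioo (0 : ℝ) 2)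
    (k j l : ℕ) (hl : l ≤ 1) :
    ∃ N : ℝ, 0 < N ∧
      ∀ lam : ℝ, 0 ≤ lam →
        ∀ (μc a0 c0 : ℝ → ℝ) (aij : Fin d → Fin d → ℝ → ℝ),
          CoeffOK d ν α μc a0 c0 aij →
          ∀ u : ℝ × Ed d → ℝ,
            (∃ U : Set (ℝ × Ed d), IsOpen U ∧ closure (Qo d α 1) ⊆ U ∧
              ContDiffOn ℝ (⊤ : ℕ∞) u U) →
            (∀ z ∈ closure (Qo d α 1), xd z.2 = 0 → u z = 0) →
            (∀ᵐ z ∂(volume.restrict (Qo d α 1)),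
              a0 (xd z.2) * ut u z + lam * c0 (xd z.2) * u z -
                μc (xd z.2) * ∑ i, ∑ j', aij i j' (xd z.2) *
                  D2u u z (EuclideanSpace.single i 1) (EuclideanSpace.single j' 1)
                = 0) →
            ∀ L : List (Fin d), L.length = j → (∀ i ∈ L, (i : ℕ) < d - 1) →
              ∫⁻ z in Qo d α (1 / 2),
                  ENNReal.ofReal
                    ((td^[k] (L.foldr pd
                        ((pd (⟨d - 1, by omega⟩ : Fin d))^[l] u)) z) ^ 2)
                ≤ ENNReal.ofReal N *
                    ∫⁻ z in Qo d α 1, ENNReal.ofReal ((u z) ^ 2) := by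
  have hν0 := hν.1
  obtain ⟨N, hN, H⟩ := exists_derivative_bound hd (κ := ν ^ 3) (pow_pos hν0 3)
    (pow_le_one₀ hν0.le hν.2.le) hα.1 hα.2 k j l hl
  refine ⟨N, hN, ?_⟩
  intro lam hlam μc a0 c0 aij hc u hu hb heq L hL hL'
  obtain ⟨U, hU, hKU, hu⟩ := hu
  obtain ⟨χ, hχ, -, hχ1, hχs⟩ := exists_smooth_cutoff isClosed_closure hU hKU
  have hv := contDiff_mul_cutoff hU hχ hχs hu
  have huv : EqOn u (fun z => χ z * u z) (closure (Qo d α 1)) := fun z hz => by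
    simp [hχ1 z hz]
  set v : ℝ × Ed d → ℝ := fun z => χ z * u z
  have hQ := huv.mono subset_closure
  have hsol := sol_of_eqOn (hd := hd) hc hν0 hv huv hb heq
  have hL2 : ∀ i ∈ L, i ≠ lastIdx hd := fun i hi h => by
    have := hL' i hi
    rw [h] at this
    exact lt_irrefl _ this
  have key := H lam _ _ _ hlam (hc.coef (hd := hd) hν0 hν.2) v hsol L hL hL2
  have hs1 := (dv_iterate hv 0 (ei (lastIdx hd)) l).1
  have hs2 := (dv_foldr hs1 0 L).1
  have hs3 := (dv_iterate hs2 0 (et d) k).1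
  have e1 : ∫⁻ z in Qo d α 1, ENNReal.ofReal ((u z) ^ 2) =
      ∫⁻ z in Qo d α 1, ENNReal.ofReal ((v z) ^ 2) :=
    setLIntegral_congr_fun isOpen_Qo.measurableSet fun z hz => by
      rw [hQ hz]
  have hsub : Qo d α (1 / 2) ⊆ Qo d α 1 := Qo_mono hα.2 (by norm_num) (by norm_num)
  have e2 : ∫⁻ z in Qo d α (1 / 2), ENNReal.ofReal
        ((td^[k] (L.foldr pd ((pd (lastIdx hd))^[l] u)) z) ^ 2) =
      ∫⁻ z in Qo d α (1 / 2), ENNReal.ofReal (((dv (et d))^[k] (L.foldr (fun i f => dv (ei i) f)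
            ((dv (ei (lastIdx hd)))^[l] v))) z ^ 2) :=
    setLIntegral_congr_fun isOpen_Qo.measurableSet fun z hz => by
      rw [iterate_td_eqOn isOpen_Qo (foldr_pd_eqOn isOpen_Qo
          (iterate_pd_eqOn isOpen_Qo hQ (lastIdx hd) l) L) k (hsub hz),
        iterate_pd_eq_dv hv, foldr_pd_eq_dv hs1, iterate_td_eq_dv hs2]
  refine (le_of_eq e2).trans ?_
  rw [e1, lintegral_sq_eq hs3.continuous, lintegral_sq_eq hv.continuous,
    ← ENNReal.ofReal_mul hN.le]
  exact ENNReal.ofReal_le_ofReal key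
end
end
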